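/- Let k > ω be a cardinal. Let X₁ and X₂ be dense F_σδ-subsets of the Baire space B(k) such that X₁ and X₂ are sets of first category and nowhere σLW(<k) + 𝒢_δσ. Then there exists a homeomorphism f : B(k) → B(k) such that f(X₁) = X₂. -/

import Mathlib

open Topology Set Filter

universe u v

noncomputable section

/-- Strong zero-dimensionality (`Ind X = 0`): any two disjoint closed sets
can be separated by a clopen set. -/
def StronglyZeroDim (X : Type*) [TopologicalSpace X] : Prop :=
  ∀ A B : Set X, IsClosed A → IsClosed B → Disjoint A B →
    ∃ U : Set X, IsClopen U ∧ A ⊆ U ∧ Disjoint B U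

/-- The topological weight of a space: the least cardinality of a base. -/
def topWeight (X : Type u) [TopologicalSpace X] : Cardinal.{u} :=
  ⨅ B : {B : Set (Set X) // TopologicalSpace.IsTopologicalBasis B}, Cardinal.mk B.1

/-- The space has a base of cardinality `< k`. -/
def WeightLT (X : Type u) [TopologicalSpace X] (k : Cardinal.{u}) : Prop :=
  ∃ B : Set (Set X), TopologicalSpace.IsTopologicalBasis B ∧ Cardinal.mk B < k

/-- Every point has a neighborhood of weight `< k`. -/
def LocallyWeightLT (X : Type u) [TopologicalSpace X] (k : Cardinal.{u}) : Prop :=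
  ∀ x : X, ∃ s : Set X, s ∈ nhds x ∧ WeightLT ↥s k

/-- `X ∈ σLW(<k)`: `X` is a countable union of subspaces, each locally of weight `< k`. -/
def SigmaLW (X : Type u) [TopologicalSpace X] (k : Cardinal.{u}) : Prop :=
  ∃ S : ℕ → Set X, (⋃ n, S n) = Set.univ ∧ ∀ n, LocallyWeightLT ↥(S n) k

/-- A `G_δσ`-subset: a countable union of `G_δ`-sets. -/
def IsGdeltaSigma {Y : Type*} [TopologicalSpace Y] (s : Set Y) : Prop :=
  ∃ G : ℕ → Set Y, (∀ n, IsGδ (G n)) ∧ s = ⋃ n, G n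

/-- An `F_σ`-subset: a countable union of closed sets. -/
def IsFsigmaSet {Y : Type*} [TopologicalSpace Y] (s : Set Y) : Prop :=
  ∃ F : ℕ → Set Y, (∀ n, IsClosed (F n)) ∧ s = ⋃ n, F n

/-- An `F_σδ`-subset: a countable intersection of `F_σ`-sets. -/
def IsFsigmaDelta {Y : Type*} [TopologicalSpace Y] (s : Set Y) : Prop :=
  ∃ F : ℕ → Set Y, (∀ n, IsFsigmaSet (F n)) ∧ s = ⋂ n, F n

/-- An absolute `G_δσ`-set: a metrizable space whose image under every embedding
into a metrizable space is a countable union of `G_δ`-sets. -/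
def AbsGdeltaSigma (X : Type u) [TopologicalSpace X] : Prop :=
  TopologicalSpace.MetrizableSpace X ∧
    ∀ (Y : Type u) [TopologicalSpace Y] [TopologicalSpace.MetrizableSpace Y]
      (f : X → Y), Topology.IsEmbedding f → IsGdeltaSigma (Set.range f)

/-- An absolute `F_σδ`-set: a metrizable space whose image under every embedding
into a metrizable space is an `F_σδ`-set. -/
def AbsFsigmaDelta (X : Type u) [TopologicalSpace X] : Prop :=
  TopologicalSpace.MetrizableSpace X ∧
    ∀ (Y : Type u) [TopologicalSpace Y] [TopologicalSpace.MetrizableSpace Y]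
      (f : X → Y), Topology.IsEmbedding f → IsFsigmaDelta (Set.range f)

/-- `X ∈ σLW(<k) + 𝒢_δσ` : `X = A ∪ B` with `A ∈ σLW(<k)` and `B` an absolute
`G_δσ`-set. -/
def SLWplusGDS (X : Type u) [TopologicalSpace X] (k : Cardinal.{u}) : Prop :=
  ∃ A B : Set X, A ∪ B = Set.univ ∧ SigmaLW ↥A k ∧ AbsGdeltaSigma ↥B

/-- No nonempty open subspace is `σLW(<k) + 𝒢_δσ`. -/
def NowhereSLWplusGDS (X : Type u) [TopologicalSpace X] (k : Cardinal.{u}) : Prop :=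
  ∀ U : Set X, IsOpen U → U.Nonempty → ¬ SLWplusGDS ↥U k

/-- A space is of first category if it is meager in itself. -/
def FirstCategory (X : Type*) [TopologicalSpace X] : Prop :=
  IsMeagre (Set.univ : Set X)

/-- A Souslin (analytic) subset of a space:
`s = ⋃_{t ∈ ω^ω} ⋂_n F(t↾n)` for a family of closed sets indexed by finite tuples. -/
def IsSuslinIn {Y : Type*} [TopologicalSpace Y] (s : Set Y) : Prop :=
  ∃ F : List ℕ → Set Y, (∀ l, IsClosed (F l)) ∧
    s = ⋃ t : ℕ → ℕ, ⋂ n : ℕ, F (List.ofFn fun i : Fin n => t i)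

/-- An absolute Souslin space: metrizable, and Souslin in every completely metrizable
space into which it embeds. -/
def AbsSuslin (X : Type u) [TopologicalSpace X] : Prop :=
  TopologicalSpace.MetrizableSpace X ∧
    ∀ (Y : Type u) [MetricSpace Y] [CompleteSpace Y] (f : X → Y),
      Topology.IsEmbedding f → IsSuslinIn (Set.range f)

/-- An h-homogeneous space: every nonempty clopen subset is homeomorphic to the
whole space. -/
def HHomogeneous (X : Type*) [TopologicalSpace X] : Prop :=
  ∀ U : Set X, IsClopen U → U.Nonempty → Nonempty (↥U ≃ₜ X)

/-- A discrete family of sets: every point has a neighborhood meeting at most one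
member of the family. -/
def DiscreteFamily {X : Type*} [TopologicalSpace X] {ι : Type*} (f : ι → Set X) : Prop :=
  ∀ x : X, ∃ U ∈ nhds x, {i | (f i ∩ U).Nonempty}.Subsingleton

/-- A discrete space of cardinality `k`. -/
def DiscT (k : Cardinal.{u}) : Type u := k.out

instance (k : Cardinal.{u}) : TopologicalSpace (DiscT k) := ⊥
instance (k : Cardinal.{u}) : DiscreteTopology (DiscT k) := ⟨rfl⟩

/-- The Baire space `B(k) = k^ω`. -/
def BaireB (k : Cardinal.{u}) : Type u := ℕ → DiscT k

instance (k : Cardinal.{u}) : TopologicalSpace (BaireB k) :=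
  inferInstanceAs (TopologicalSpace (ℕ → DiscT k))

open Classical in
/-- The discrete factor of `B*(k)`: two points if `k = ℵ₀`, and `k` points otherwise. -/
def StarT (k : Cardinal.{u}) : Type u :=
  if k = Cardinal.aleph0 then ULift Bool else DiscT k

instance (k : Cardinal.{u}) : TopologicalSpace (StarT k) := ⊥
instance (k : Cardinal.{u}) : DiscreteTopology (StarT k) := ⟨rfl⟩

/-- `B*(k)`: the Cantor set `2^ω` if `k = ℵ₀`, and the Baire space `B(k)` if `k > ℵ₀`. -/
def BaireStar (k : Cardinal.{u}) : Type u := ℕ → StarT k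

instance (k : Cardinal.{u}) : TopologicalSpace (BaireStar k) :=
  inferInstanceAs (TopologicalSpace (ℕ → StarT k))

/-- A discrete space of cardinality `k` (for infinite `k`), with a distinguished basepoint. -/
def QBase (k : Cardinal.{u}) : Type u := DiscT k ⊕ PUnit.{u + 1}

instance (k : Cardinal.{u}) : TopologicalSpace (QBase k) := ⊥
instance (k : Cardinal.{u}) : DiscreteTopology (QBase k) := ⟨rfl⟩

/-- `Q(k)`: the σ-product of `ω` copies of a discrete space of cardinality `k`, i.e.
the subspace of the product consisting of the sequences eventually equal to the basepoint. -/
def Qk (k : Cardinal.{u}) : Type u :=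
  {x : ℕ → QBase k // ∀ᶠ n in Filter.atTop, x n = Sum.inr PUnit.unit}

instance (k : Cardinal.{u}) : TopologicalSpace (Qk k) :=
  inferInstanceAs (TopologicalSpace
    {x : ℕ → QBase k // ∀ᶠ n in Filter.atTop, x n = Sum.inr PUnit.unit})

/-- The countable power `Q(k)^ω`. -/
def QkOmega (k : Cardinal.{u}) : Type u := ℕ → Qk k

instance (k : Cardinal.{u}) : TopologicalSpace (QkOmega k) :=
  inferInstanceAs (TopologicalSpace (ℕ → Qk k))

/-- `Z` is homeomorphic to `Q(k)^ω`. -/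
def IsQkOmega (k : Cardinal.{u}) (Z : Type*) [TopologicalSpace Z] : Prop :=
  Nonempty (Z ≃ₜ QkOmega k)

/-- `Z` is homeomorphic to `A^{II}_k`, the complement in `B*(k)` of a dense copy of
`Q(k)^ω`. -/
def IsAII (k : Cardinal.{u}) (Z : Type*) [TopologicalSpace Z] : Prop :=
  ∃ A : Set (BaireStar k), Dense A ∧ IsQkOmega k ↥A ∧ Nonempty (Z ≃ₜ ↥(Aᶜ))

/-- `Z` is homeomorphic to `A^I_k = Q × A^{II}_k`. -/
def IsAI (k : Cardinal.{u}) (Z : Type*) [TopologicalSpace Z] : Prop :=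
  ∃ A : Set (BaireStar k), Dense A ∧ IsQkOmega k ↥A ∧ Nonempty (Z ≃ₜ (ℚ × ↥(Aᶜ)))

/-- `Z` is homeomorphic to `M^{II}_k`, the complement in `B*(k)` of a dense copy of
`A^I_k`. -/
def IsMII (k : Cardinal.{u}) (Z : Type*) [TopologicalSpace Z] : Prop :=
  ∃ Y : Set (BaireStar k), Dense Y ∧ IsAI k ↥Y ∧ Nonempty (Z ≃ₜ ↥(Yᶜ))

/-- `X ∈ 𝓕_σδ ∖ σLW(<k)`: `X` is homeomorphic to `F ∖ L` for some absolute
`F_σδ`-space `F` and some `L ⊆ F` with `L ∈ σLW(<k)`. -/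
def FsdMinusSLW (X : Type u) [TopologicalSpace X] (k : Cardinal.{u}) : Prop :=
  ∃ (F : TopCat.{u}) (L : Set F), AbsFsigmaDelta ↥F ∧ SigmaLW ↥L k ∧
    Nonempty (X ≃ₜ ↥(Lᶜ))

/-- No nonempty open subspace is in the class `𝓕_σδ ∖ σLW(<k)`. -/
def NowhereFsdMinusSLW (X : Type u) [TopologicalSpace X] (k : Cardinal.{u}) : Prop :=
  ∀ U : Set X, IsOpen U → U.Nonempty → ¬ FsdMinusSLW ↥U k

/-- A topologically complete (i.e. completely metrizable) space. -/
def CompletelyMetrizable (X : Type*) [t : TopologicalSpace X] : Prop :=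
  ∃ m : MetricSpace X, m.toUniformSpace.toTopologicalSpace = t ∧
    @CompleteSpace X m.toUniformSpace

end


section PartOne

set_option linter.unusedSectionVars false

variable {κ : Type u}

/-- Cylinder of length `n` around `x`. -/
def cyl (x : ℕ → κ) (n : ℕ) : Set (ℕ → κ) := {y | ∀ i < n, y i = x i}

theorem mem_cyl_self (x : ℕ → κ) (n : ℕ) : x ∈ cyl x n := fun _ _ => rfl

theorem cyl_anti (x : ℕ → κ) {m n : ℕ} (h : m ≤ n) : cyl x n ⊆ cyl x m :=
  fun _ hy i hi => hy i (hi.trans_le h)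

theorem mem_cyl_comm {x y : ℕ → κ} {n : ℕ} (h : y ∈ cyl x n) : x ∈ cyl y n :=
  fun i hi => (h i hi).symm

theorem mem_cyl_trans {x y z : ℕ → κ} {n : ℕ} (h : y ∈ cyl x n) (h' : z ∈ cyl y n) :
    z ∈ cyl x n :=
  fun i hi => (h' i hi).trans (h i hi)

theorem cyl_eq {x y : ℕ → κ} {n : ℕ} (h : y ∈ cyl x n) : cyl y n = cyl x n :=
  Subset.antisymm (fun _ hz => mem_cyl_trans h hz) (fun _ hz => mem_cyl_trans (mem_cyl_comm h) hz)

theorem cyl_subset {x y : ℕ → κ} {n m : ℕ} (h : y ∈ cyl x n) (hm : n ≤ m) :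
    cyl y m ⊆ cyl x n :=
  (cyl_anti y hm).trans (cyl_eq h).subset

theorem cyl_zero (x : ℕ → κ) : cyl x 0 = univ :=
  eq_univ_of_forall fun _ _ h => absurd h (Nat.not_lt_zero _)

/-- The set of all cylinders around points of `T` of length `n`. -/
def nodes (T : Set (ℕ → κ)) (n : ℕ) : Set (Set (ℕ → κ)) := (fun x => cyl x n) '' T

/-- A set with fewer than `#κ` nodes. -/
def Thin (T : Set (ℕ → κ)) : Prop := Cardinal.mk (⋃ n, nodes T n : Set (Set (ℕ → κ))) < Cardinal.mk κ

theorem nodes_mono {S T : Set (ℕ → κ)} (h : S ⊆ T) (n : ℕ) : nodes S n ⊆ nodes T n :=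
  image_mono h

theorem Thin.mono {S T : Set (ℕ → κ)} (h : S ⊆ T) (hT : Thin T) : Thin S :=
  (Cardinal.mk_le_mk_of_subset (iUnion_mono fun n => nodes_mono h n)).trans_lt hT

/-- Locally thin sets. -/
def LW (S : Set (ℕ → κ)) : Prop := ∀ x ∈ S, ∃ m, Thin (S ∩ cyl x m)

variable [TopologicalSpace κ] [DiscreteTopology κ]

theorem isOpen_cyl (x : ℕ → κ) (n : ℕ) : IsOpen (cyl x n) :=
  PiNat.isOpen_cylinder (fun _ => κ) x n

theorem exists_cyl_subset {O : Set (ℕ → κ)} (hO : IsOpen O) {x : ℕ → κ} (hx : x ∈ O) :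
    ∃ m, cyl x m ⊆ O := by
  obtain ⟨C, ⟨y, n, rfl⟩, hxC, hC⟩ :=
    (PiNat.isTopologicalBasis_cylinders (fun _ => κ)).exists_subset_of_mem_open hx hO
  exact ⟨n, (cyl_eq (x := y) (y := x) hxC).subset.trans hC⟩

theorem exists_cyl_subset' {O : Set (ℕ → κ)} (hO : IsOpen O) {x : ℕ → κ} (hx : x ∈ O) (N : ℕ) :
    ∃ m, N ≤ m ∧ cyl x m ⊆ O := by
  obtain ⟨m, hm⟩ := exists_cyl_subset hO hx
  exact ⟨max N m, le_max_left _ _, (cyl_anti x (le_max_right _ _)).trans hm⟩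

theorem isOpen_of_cyl {O : Set (ℕ → κ)} (h : ∀ x ∈ O, ∃ m, cyl x m ⊆ O) : IsOpen O := by
  rw [isOpen_iff_forall_mem_open]
  intro x hx
  obtain ⟨m, hm⟩ := h x hx
  exact ⟨_, hm, isOpen_cyl x m, mem_cyl_self x m⟩

theorem isClosed_cyl (x : ℕ → κ) (n : ℕ) : IsClosed (cyl x n) := by
  constructor
  apply isOpen_of_cyl
  intro y hy
  exact ⟨n, fun z hz hz' => hy (mem_cyl_trans hz' (mem_cyl_comm hz))⟩

theorem mem_closure_cyl {E : Set (ℕ → κ)} {x : ℕ → κ} :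
    x ∈ closure E ↔ ∀ m, ∃ y ∈ E, y ∈ cyl x m := by
  constructor
  · intro h m
    obtain ⟨y, hy, hyE⟩ := mem_closure_iff.1 h _ (isOpen_cyl x m) (mem_cyl_self x m)
    exact ⟨y, hyE, hy⟩
  · intro h
    rw [mem_closure_iff]
    intro O hO hx
    obtain ⟨m, hm⟩ := exists_cyl_subset hO hx
    obtain ⟨y, hy, hy'⟩ := h m
    exact ⟨y, hm hy', hy⟩

theorem gdelta_of_closed {C : Set (ℕ → κ)} (hC : IsClosed C) : IsGδ C := by
  have : C = ⋂ n : ℕ, ⋃ x ∈ C, cyl x n := by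
    apply Subset.antisymm
    · intro x hx
      simp only [mem_iInter, mem_iUnion]
      exact fun n => ⟨x, hx, mem_cyl_self x n⟩
    · intro x hx
      rw [← hC.closure_eq, mem_closure_cyl]
      intro m
      simp only [mem_iInter, mem_iUnion] at hx
      obtain ⟨y, hy, hxy⟩ := hx m
      exact ⟨y, hy, mem_cyl_comm hxy⟩
  rw [this]
  exact IsGδ.iInter_of_isOpen fun n => isOpen_biUnion fun x _ => isOpen_cyl x n

/-- Small sets, relative to `Y` and `M`. -/
def Sm (Y M E : Set (ℕ → κ)) : Prop :=
  ∃ (S T : ℕ → Set (ℕ → κ)) (H : Set (ℕ → κ)), (∀ n, LW (S n)) ∧ (∀ n, IsGδ (T n) ∧ T n ⊆ Y) ∧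
    IsGδ H ∧ Disjoint H M ∧ E ⊆ (⋃ n, S n) ∪ (⋃ n, T n) ∪ H

theorem LW_empty : LW (∅ : Set (ℕ → κ)) := fun _ hx => hx.elim

theorem Sm.mono {Y M E E' : Set (ℕ → κ)} (h : E' ⊆ E) (hE : Sm Y M E) : Sm Y M E' := by
  obtain ⟨S, T, H, h1, h2, h3, h4, h5⟩ := hE
  exact ⟨S, T, H, h1, h2, h3, h4, h.trans h5⟩

theorem Sm.mono_M {Y M M' E : Set (ℕ → κ)} (h : M' ⊆ M) (hE : Sm Y M E) : Sm Y M' E := by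
  obtain ⟨S, T, H, h1, h2, h3, h4, h5⟩ := hE
  exact ⟨S, T, H, h1, h2, h3, h4.mono_right h, h5⟩

theorem Sm.union {Y M E E' : Set (ℕ → κ)} (hE : Sm Y M E) (hE' : Sm Y M E') :
    Sm Y M (E ∪ E') := by
  obtain ⟨S, T, H, h1, h2, h3, h4, h5⟩ := hE
  obtain ⟨S', T', H', h1', h2', h3', h4', h5'⟩ := hE'
  refine ⟨fun n => Sum.elim S S' (Equiv.natSumNatEquivNat.symm n),
    fun n => Sum.elim T T' (Equiv.natSumNatEquivNat.symm n), H ∪ H', ?_, ?_, h3.union h3', ?_, ?_⟩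
  · intro n
    beta_reduce
    cases Equiv.natSumNatEquivNat.symm n with
    | inl a => exact h1 a
    | inr a => exact h1' a
  · intro n
    beta_reduce
    cases Equiv.natSumNatEquivNat.symm n with
    | inl a => exact h2 a
    | inr a => exact h2' a
  · exact h4.union_left h4'
  · rintro x (hx | hx)
    · rcases h5 hx with (hx | hx) | hx
      · obtain ⟨n, hn⟩ := mem_iUnion.1 hx
        exact Or.inl (Or.inl (mem_iUnion.2 ⟨Equiv.natSumNatEquivNat (Sum.inl n), by simpa using hn⟩))
      · obtain ⟨n, hn⟩ := mem_iUnion.1 hx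
        exact Or.inl (Or.inr (mem_iUnion.2 ⟨Equiv.natSumNatEquivNat (Sum.inl n), by simpa using hn⟩))
      · exact Or.inr (Or.inl hx)
    · rcases h5' hx with (hx | hx) | hx
      · obtain ⟨n, hn⟩ := mem_iUnion.1 hx
        exact Or.inl (Or.inl (mem_iUnion.2 ⟨Equiv.natSumNatEquivNat (Sum.inr n), by simpa using hn⟩))
      · obtain ⟨n, hn⟩ := mem_iUnion.1 hx
        exact Or.inl (Or.inr (mem_iUnion.2 ⟨Equiv.natSumNatEquivNat (Sum.inr n), by simpa using hn⟩))
      · exact Or.inr (Or.inr hx)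

/-- If `E` is small with respect to all `M n`, then it is small with respect to their union. -/
theorem Sm.of_forall {Y E : Set (ℕ → κ)} {M : ℕ → Set (ℕ → κ)} (hE : ∀ n, Sm Y (M n) E) :
    Sm Y (⋃ n, M n) E := by
  choose S T H h1 h2 h3 h4 h5 using hE
  refine ⟨fun n => S (Nat.unpair n).1 (Nat.unpair n).2, fun n => T (Nat.unpair n).1 (Nat.unpair n).2,
    ⋂ n, H n, fun n => h1 _ _, fun n => h2 _ _, IsGδ.iInter h3, ?_, ?_⟩
  · rw [Set.disjoint_left]
    intro x hx hx'
    obtain ⟨n, hn⟩ := mem_iUnion.1 hx'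
    exact Set.disjoint_left.1 (h4 n) (mem_iInter.1 hx n) hn
  · intro x hx
    by_cases h : ∀ n, x ∈ H n
    · exact Or.inr (mem_iInter.2 h)
    · push Not at h
      obtain ⟨n, hn⟩ := h
      rcases h5 n hx with (hx | hx) | hx
      · obtain ⟨i, hi⟩ := mem_iUnion.1 hx
        exact Or.inl (Or.inl (mem_iUnion.2 ⟨Nat.pair n i, by simpa using hi⟩))
      · obtain ⟨i, hi⟩ := mem_iUnion.1 hx
        exact Or.inl (Or.inr (mem_iUnion.2 ⟨Nat.pair n i, by simpa using hi⟩))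
      · exact absurd hx hn

/-- Countable unions of small sets (`M = Yᶜ`). -/
theorem Sm.iUnion {Y : Set (ℕ → κ)} {E : ℕ → Set (ℕ → κ)} (hE : ∀ n, Sm Y Yᶜ (E n)) :
    Sm Y Yᶜ (⋃ n, E n) := by
  choose S T H h1 h2 h3 h4 h5 using hE
  refine ⟨fun n => S (Nat.unpair n).1 (Nat.unpair n).2,
    fun n => Nat.rec (H (Nat.unpair n).1) (fun m _ => T (Nat.unpair n).1 m) (Nat.unpair n).2,
    ∅, fun n => h1 _ _, ?_, IsGδ.empty, empty_disjoint _, ?_⟩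
  · intro n
    beta_reduce
    cases (Nat.unpair n).2 with
    | zero => exact ⟨h3 _, disjoint_compl_right_iff_subset.1 (h4 _)⟩
    | succ m => exact h2 _ _
  · intro x hx
    obtain ⟨n, hx⟩ := mem_iUnion.1 hx
    rcases h5 n hx with (hx | hx) | hx
    · obtain ⟨i, hi⟩ := mem_iUnion.1 hx
      exact Or.inl (Or.inl (mem_iUnion.2 ⟨Nat.pair n i, by simpa using hi⟩))
    · obtain ⟨i, hi⟩ := mem_iUnion.1 hx
      exact Or.inl (Or.inr (mem_iUnion.2 ⟨Nat.pair n (i+1), by simpa using hi⟩))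
    · exact Or.inl (Or.inr (mem_iUnion.2 ⟨Nat.pair n 0, by simpa using hx⟩))

theorem gdelta_glue {O : Set (ℕ → κ)} {C : (ℕ → κ) → Set (ℕ → κ)}
    (hO : IsOpen O) (hC : ∀ x ∈ O, ∃ m, ∀ y ∈ cyl x m, C y = C x)
    {G : Set (ℕ → κ) → Set (ℕ → κ)} (hG : ∀ x ∈ O, IsGδ (G (C x))) :
    IsGδ {x | x ∈ O ∧ x ∈ G (C x)} := by
  have : ∀ D : Set (ℕ → κ), ∃ W : ℕ → Set (ℕ → κ), IsGδ (G D) → (∀ n, IsOpen (W n)) ∧ G D = ⋂ n, W n := by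
    intro D
    by_cases hD : IsGδ (G D)
    · obtain ⟨W, hW, hW'⟩ := isGδ_iff_eq_iInter_nat.1 hD
      exact ⟨W, fun _ => ⟨hW, hW'⟩⟩
    · exact ⟨fun _ => ∅, fun h => absurd h hD⟩
  choose W hW using this
  have key : {x | x ∈ O ∧ x ∈ G (C x)} = O ∩ ⋂ n, {x | x ∈ O ∧ x ∈ W (C x) n} := by
    ext x
    simp only [mem_ofPred_eq, mem_inter_iff, mem_iInter]
    constructor
    · rintro ⟨hx, hx'⟩
      refine ⟨hx, fun n => ⟨hx, ?_⟩⟩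
      rw [(hW (C x) (hG x hx)).2] at hx'
      exact mem_iInter.1 hx' n
    · rintro ⟨hx, hx'⟩
      refine ⟨hx, ?_⟩
      rw [(hW (C x) (hG x hx)).2]
      exact mem_iInter.2 fun n => (hx' n).2
  rw [key]
  refine hO.isGδ.inter (IsGδ.iInter_of_isOpen fun n => ?_)
  apply isOpen_of_cyl
  rintro x ⟨hx, hx'⟩
  obtain ⟨m, hm⟩ := hC x hx
  obtain ⟨m1, hm1⟩ := exists_cyl_subset hO hx
  obtain ⟨m2, hm2⟩ := exists_cyl_subset ((hW (C x) (hG x hx)).1 n) hx'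
  refine ⟨max m (max m1 m2), fun y hy => ⟨hm1 (cyl_anti x (by simp) hy), ?_⟩⟩
  rw [hm y (cyl_anti x (by simp) hy)]
  exact hm2 (cyl_anti x (by simp) hy)

theorem Sm.of_local {Y M E : Set (ℕ → κ)} (h : ∀ x ∈ E, ∃ m, Sm Y M (E ∩ cyl x m)) : Sm Y M E := by
  classical
  set O : Set (ℕ → κ) := {x | ∃ m, Sm Y M (E ∩ cyl x m)} with hOdef
  let μ : (ℕ → κ) → ℕ := fun x => if hx : ∃ m, Sm Y M (E ∩ cyl x m) then Nat.find hx else 0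
  have hμ : ∀ x ∈ O, Sm Y M (E ∩ cyl x (μ x)) := by
    intro x hx
    have hx' : ∃ m, Sm Y M (E ∩ cyl x m) := hx
    simp only [μ, dif_pos hx']
    exact Nat.find_spec hx'
  have hμmin : ∀ x ∈ O, ∀ m, Sm Y M (E ∩ cyl x m) → μ x ≤ m := by
    intro x hx m hm
    have hx' : ∃ m, Sm Y M (E ∩ cyl x m) := hx
    simp only [μ, dif_pos hx']
    exact Nat.find_min' hx' hm
  have hsub : ∀ x ∈ O, cyl x (μ x) ⊆ O := by
    intro x hx y hy
    refine ⟨μ x, ?_⟩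
    rw [cyl_eq hy]
    exact hμ x hx
  have hμle : ∀ x ∈ O, ∀ y ∈ cyl x (μ x), μ y ≤ μ x := by
    intro x hx y hy
    apply hμmin y (hsub x hx hy)
    rw [cyl_eq hy]
    exact hμ x hx
  have hμeq : ∀ x ∈ O, ∀ y ∈ cyl x (μ x), μ y = μ x := by
    intro x hx y hy
    apply le_antisymm (hμle x hx y hy)
    apply hμle y (hsub x hx hy)
    exact cyl_anti y (hμle x hx y hy) (mem_cyl_comm hy)
  let C : (ℕ → κ) → Set (ℕ → κ) := fun x => cyl x (μ x)
  have hCeq : ∀ x ∈ O, ∀ y ∈ cyl x (μ x), C y = C x := by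
    intro x hx y hy
    simp only [C]
    rw [hμeq x hx y hy, cyl_eq hy]
  have hO : IsOpen O := isOpen_of_cyl fun x hx => ⟨_, hsub x hx⟩
  have hdata : ∀ D : Set (ℕ → κ), ∃ (S T : ℕ → Set (ℕ → κ)) (H : Set (ℕ → κ)), Sm Y M (E ∩ D) →
    (∀ n, LW (S n)) ∧ (∀ n, IsGδ (T n) ∧ T n ⊆ Y) ∧
    IsGδ H ∧ Disjoint H M ∧ E ∩ D ⊆ (⋃ n, S n) ∪ (⋃ n, T n) ∪ H := by
    intro D
    by_cases hD : Sm Y M (E ∩ D)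
    · obtain ⟨S, T, H, hh⟩ := hD
      exact ⟨S, T, H, fun _ => hh⟩
    · exact ⟨fun _ => ∅, fun _ => ∅, ∅, fun h => absurd h hD⟩
  choose S T H hh using hdata
  have hh' : ∀ x ∈ O, _ := fun x hx => hh (C x) (hμ x hx)
  refine ⟨fun n => {x | x ∈ O ∧ x ∈ S (C x) n}, fun n => {x | x ∈ O ∧ x ∈ T (C x) n},
    {x | x ∈ O ∧ x ∈ H (C x)}, ?_, ?_, ?_, ?_, ?_⟩
  · rintro n x ⟨hx, hx'⟩
    obtain ⟨m, hm⟩ := (hh' x hx).1 n x hx'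
    refine ⟨max m (μ x), hm.mono ?_⟩
    rintro y ⟨⟨hy, hy'⟩, hyc⟩
    refine ⟨?_, cyl_anti x (le_max_left _ _) hyc⟩
    rwa [hCeq x hx y (cyl_anti x (le_max_right _ _) hyc)] at hy'
  · intro n
    refine ⟨gdelta_glue hO (fun x hx => ⟨μ x, hCeq x hx⟩) (G := fun D => T D n)
      fun x hx => ((hh' x hx).2.1 n).1, ?_⟩
    rintro x ⟨hx, hx'⟩
    exact ((hh' x hx).2.1 n).2 hx'
  · exact gdelta_glue hO (fun x hx => ⟨μ x, hCeq x hx⟩) (G := fun D => H D)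
      fun x hx => (hh' x hx).2.2.1
  · rw [Set.disjoint_left]
    rintro x ⟨hx, hx'⟩ hxM
    exact Set.disjoint_left.1 (hh' x hx).2.2.2.1 hx' hxM
  · intro x hxE
    have hx : x ∈ O := h x hxE
    rcases (hh' x hx).2.2.2.2 ⟨hxE, mem_cyl_self _ _⟩ with (h | h) | h
    · obtain ⟨n, hn⟩ := mem_iUnion.1 h
      exact Or.inl (Or.inl (mem_iUnion.2 ⟨n, hx, hn⟩))
    · obtain ⟨n, hn⟩ := mem_iUnion.1 h
      exact Or.inl (Or.inr (mem_iUnion.2 ⟨n, hx, hn⟩))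
    · exact Or.inr ⟨hx, h⟩

/-- Kernel. -/
theorem Sm.kernel {Y M E : Set (ℕ → κ)} (h : ¬ Sm Y M E) :
    ∃ E' ⊆ E, E'.Nonempty ∧ ∀ x ∈ E', ∀ m, ¬ Sm Y M (E' ∩ cyl x m) := by
  set U : Set (ℕ → κ) := {x | ∃ m, Sm Y M (E ∩ cyl x m)} with hU
  have hEU : Sm Y M (E ∩ U) := by
    apply Sm.of_local
    rintro x ⟨hxE, m, hm⟩
    exact ⟨m, Sm.mono (E := E ∩ cyl x m) (fun y hy => ⟨hy.1.1, hy.2⟩) hm⟩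
  refine ⟨E \ U, sdiff_subset, ?_, ?_⟩
  · by_contra hne
    rw [not_nonempty_iff_eq_empty, sdiff_eq_empty] at hne
    exact h (Sm.mono (E := E ∩ U) (fun x hx => ⟨hx, hne hx⟩) hEU)
  · rintro x ⟨hxE, hxU⟩ m hm
    apply hxU
    refine ⟨m, (hm.union hEU).mono ?_⟩
    rintro y ⟨hy, hyc⟩
    by_cases hyU : y ∈ U
    · exact Or.inr ⟨hy, hyU⟩
    · exact Or.inl ⟨⟨hy, hyU⟩, hyc⟩

/-- Kernel sets. -/
def Kern (F : ℕ → ℕ → Set (ℕ → κ)) (Y : Set (ℕ → κ)) (n : ℕ) (E : Set (ℕ → κ)) : Prop :=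
  E ⊆ Y ∧ E.Nonempty ∧ ∀ x ∈ E, ∀ m, ¬ Sm Y Yᶜ (E ∩ cyl x m) ∧
    ∃ z ∈ closure E, z ∈ cyl x m ∧ ∀ i, z ∉ F n i

theorem exists_kern {F : ℕ → ℕ → Set (ℕ → κ)} {Y : Set (ℕ → κ)} (hY : Y = ⋂ n, ⋃ i, F n i)
    {E : Set (ℕ → κ)} (hEY : E ⊆ Y) (hE : ¬ Sm Y Yᶜ E) : ∃ n, ∃ E' ⊆ E, Kern F Y n E' := by
  have hM : Yᶜ = ⋃ n, (⋃ i, F n i)ᶜ := by rw [hY, compl_iInter]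
  have : ∃ n, ¬ Sm Y (⋃ i, F n i)ᶜ E := by
    by_contra hcon
    push Not at hcon
    apply hE
    rw [hM]
    exact Sm.of_forall hcon
  obtain ⟨n, hn⟩ := this
  obtain ⟨E', hE'E, hne, hk⟩ := Sm.kernel hn
  refine ⟨n, E', hE'E, hE'E.trans hEY, hne, fun x hx m => ⟨fun hs => hk x hx m (hs.mono_M ?_), ?_⟩⟩
  · rw [hM]
    exact subset_iUnion (fun n => (⋃ i, F n i)ᶜ) n
  · by_contra hcon
    push Not at hcon
    apply hk x hx m
    refine ⟨fun _ => ∅, fun _ => ∅, closure E' ∩ cyl x m, fun _ => LW_empty,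
      fun _ => ⟨IsGδ.empty, empty_subset _⟩,
      gdelta_of_closed (isClosed_closure.inter (isClosed_cyl x m)), ?_, ?_⟩
    · rw [Set.disjoint_left]
      rintro z ⟨hz, hzc⟩ hz'
      obtain ⟨i, hi⟩ := hcon z hz hzc
      exact hz' (mem_iUnion.2 ⟨i, hi⟩)
    · rintro y ⟨hy, hyc⟩
      exact Or.inr ⟨subset_closure hy, hyc⟩

/-- The basic step. -/
theorem kern_step {F : ℕ → ℕ → Set (ℕ → κ)} {Y : Set (ℕ → κ)} (hF : ∀ n i, IsClosed (F n i))
    (hY : Y = ⋂ n, ⋃ i, F n i) {n : ℕ} {E : Set (ℕ → κ)} (hE : Kern F Y n E)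
    {x : ℕ → κ} (hx : x ∈ E) (m j l : ℕ) :
    ∃ x' m' n' E', cyl x' m' ⊆ cyl x m ∧ E' ⊆ E ∧ Kern F Y n' E' ∧ (E' ∩ cyl x' m').Nonempty ∧
      (∃ b, E' ⊆ F j b) ∧ ∀ i < l, Disjoint (cyl x' m') (F n i) := by
  obtain ⟨hEY, hne, hk⟩ := hE
  obtain ⟨z, hzE, hzx, hzF⟩ := (hk x hx m).2
  have hW : IsOpen (⋂ i ∈ Finset.range l, (F n i)ᶜ) :=
    isOpen_biInter_finset fun i _ => (hF n i).isOpen_compl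
  have hzW : z ∈ (⋂ i ∈ Finset.range l, (F n i)ᶜ) := by
    simp only [mem_iInter]
    exact fun i _ => hzF i
  obtain ⟨m', hmm', hm'⟩ := exists_cyl_subset' hW hzW m
  obtain ⟨x', hx'E, hx'z⟩ := mem_closure_cyl.1 hzE m'
  have hx'eq : cyl x' m' = cyl z m' := cyl_eq hx'z
  have hb : ∃ b, ¬ Sm Y Yᶜ (E ∩ cyl x' m' ∩ F j b) := by
    by_contra hcon
    push Not at hcon
    apply (hk x' hx'E m').1
    refine (Sm.iUnion hcon).mono ?_
    intro y hy
    have : y ∈ ⋂ n, ⋃ i, F n i := hY ▸ hEY hy.1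
    obtain ⟨b, hb⟩ := mem_iUnion.1 (mem_iInter.1 this j)
    exact mem_iUnion.2 ⟨b, hy, hb⟩
  obtain ⟨b, hb⟩ := hb
  obtain ⟨n', E', hE', hK⟩ := exists_kern hY (fun y hy => hEY hy.1.1) hb
  refine ⟨x', m', n', E', ?_, fun y hy => (hE' hy).1.1, hK, ?_, ⟨b, fun y hy => (hE' hy).2⟩, ?_⟩
  · rw [hx'eq]
    exact cyl_subset hzx hmm'
  · obtain ⟨y, hy⟩ := hK.2.1
    exact ⟨y, hy, (hE' hy).1.2⟩
  · intro i hi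
    rw [Set.disjoint_left]
    intro y hy hyF
    rw [hx'eq] at hy
    have := hm' hy
    simp only [mem_iInter] at this
    exact this i (Finset.mem_range.2 hi) hyF

end PartOne


section PartTwo

set_option linter.unusedSectionVars false

variable {κ : Type u}

theorem mk_iUnion_nat_le {α : Type u} (f : ℕ → Set α) :
    Cardinal.mk (⋃ n, f n) ≤ Cardinal.sum fun i : ULift.{u} ℕ => Cardinal.mk (f i.down) := by
  have : (⋃ n, f n) = ⋃ i : ULift.{u} ℕ, f i.down := by
    ext x
    simp only [mem_iUnion]
    exact ⟨fun ⟨n, hn⟩ => ⟨⟨n⟩, hn⟩, fun ⟨n, hn⟩ => ⟨n.down, hn⟩⟩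
  rw [this]
  exact Cardinal.mk_iUnion_le_sum_mk

theorem mk_iUnion_nat_le' {α : Type u} (f : ℕ → Set α) (c : Cardinal.{u})
    (hc : Cardinal.aleph0 ≤ c) (h : ∀ n, Cardinal.mk (f n) ≤ c) :
    Cardinal.mk (⋃ n, f n) ≤ c := by
  refine (mk_iUnion_nat_le f).trans ?_
  refine (Cardinal.sum_le_sum _ (fun _ => c) fun i : ULift.{u} ℕ => h i.down).trans ?_
  rw [Cardinal.sum_const]
  simp only [Cardinal.lift_id]
  have : Cardinal.mk (ULift.{u} ℕ) = Cardinal.aleph0 := by simp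
  rw [this]
  exact (Cardinal.mul_le_max_of_aleph0_le_left le_rfl).trans (max_le hc le_rfl)

theorem mk_nodes_mono (P : Set (ℕ → κ)) {n n' : ℕ} (h : n ≤ n') :
    Cardinal.mk (nodes P n) ≤ Cardinal.mk (nodes P n') := by
  have : nodes P n = (fun C : Set (ℕ → κ) => ⋃ y ∈ C, cyl y n) '' nodes P n' := by
    unfold nodes
    rw [image_image]
    apply image_congr
    intro x _
    apply Subset.antisymm
    · intro z hz
      simp only [mem_iUnion]
      exact ⟨x, mem_cyl_self _ _, hz⟩
    · intro z hz
      simp only [mem_iUnion] at hz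
      obtain ⟨y, hy, hzy⟩ := hz
      exact mem_cyl_trans (cyl_anti x h hy) hzy
  rw [this]
  exact Cardinal.mk_image_le

theorem branch (hκ : Cardinal.aleph0 < Cardinal.mk κ) {E : Set (ℕ → κ)}
    (hE : ∀ x ∈ E, ∀ m, ¬ Thin (E ∩ cyl x m)) {x : ℕ → κ} (hx : x ∈ E) (m N : ℕ) :
    ∃ (p : κ → ℕ → κ) (q : κ → ℕ), (∀ a, p a ∈ E ∧ p a ∈ cyl x m ∧ m ≤ q a ∧ N ≤ q a) ∧
      ∀ y, ∃ m', ∀ a b, (cyl y m' ∩ cyl (p a) (q a)).Nonempty →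
        (cyl y m' ∩ cyl (p b) (q b)).Nonempty → a = b := by
  set P := E ∩ cyl x m with hP
  have hthin := hE x hx m
  unfold Thin at hthin
  rw [not_lt] at hthin
  by_cases hcase : ∃ n, Cardinal.mk κ ≤ Cardinal.mk (nodes P n)
  · obtain ⟨n, hn⟩ := hcase
    set n' := max n (max m N) with hn'
    have hle := hn.trans (mk_nodes_mono P (le_max_left n (max m N)))
    obtain ⟨ι⟩ := Cardinal.le_def _ _ |>.1 hle
    have : ∀ a, ∃ p ∈ P, cyl p n' = (ι a : Set (ℕ → κ)) := fun a => (ι a).2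
    choose p hp hpι using this
    refine ⟨p, fun _ => n', fun a => ⟨(hp a).1, (hp a).2, by simp [hn'], by simp [hn']⟩, ?_⟩
    intro y
    refine ⟨n', fun a b => ?_⟩
    rintro ⟨z, hz, hza⟩ ⟨w, hw, hwb⟩
    apply ι.injective
    apply Subtype.ext
    rw [← hpι a, ← hpι b, ← cyl_eq hza, ← cyl_eq hwb, cyl_eq hz, cyl_eq hw]
  · push Not at hcase
    have hinf : ∃ n, (nodes P n).Infinite := by
      by_contra hcon
      push Not at hcon
      have : (⋃ n, nodes P n).Countable :=
        countable_iUnion fun n => (by simpa using hcon n : (nodes P n).Finite).countable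
      exact absurd (hthin.trans (Cardinal.le_aleph0_iff_set_countable.2 this)) (not_le.2 hκ)
    obtain ⟨n1, hn1⟩ := hinf
    set n0 := max n1 (max m N) with hn0
    have hn0inf : (nodes P n0).Infinite := by
      rw [← Set.infinite_coe_iff, Cardinal.infinite_iff] at hn1 ⊢
      exact hn1.trans (mk_nodes_mono P (le_max_left _ _))
    have hw : ∀ i, ∃ w ∈ P, cyl w n0 = (hn0inf.natEmbedding _ i : Set (ℕ → κ)) :=
      fun i => (hn0inf.natEmbedding _ i).2
    choose w hwP hwι using hw
    have hwinj : ∀ i j, cyl (w i) n0 = cyl (w j) n0 → i = j := by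
      intro i j hij
      apply (hn0inf.natEmbedding _).injective
      apply Subtype.ext
      rw [← hwι, ← hwι, hij]
    have hni : ∀ i, ∃ n, n0 ≤ n ∧ Cardinal.mk (nodes P i) ≤ Cardinal.mk (nodes (E ∩ cyl (w i) n0) n) := by
      intro i
      by_contra hcon
      push Not at hcon
      apply hE (w i) (hwP i).1 n0
      unfold Thin
      refine lt_of_le_of_lt (mk_iUnion_nat_le' _ (max Cardinal.aleph0 (Cardinal.mk (nodes P i)))
        (le_max_left _ _) fun n => ?_) (max_lt hκ (hcase i))
      refine (mk_nodes_mono _ (le_max_left n n0)).trans ?_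
      exact (hcon _ (le_max_right n n0)).le.trans (le_max_right _ _)
    choose nn hnn hnn' using hni
    have hle : Cardinal.mk κ ≤
        Cardinal.mk (Σ i : ULift.{u} ℕ, nodes (E ∩ cyl (w i.down) n0) (nn i.down)) := by
      rw [Cardinal.mk_sigma]
      exact hthin.trans ((mk_iUnion_nat_le _).trans (Cardinal.sum_le_sum _ _ fun i => hnn' i.down))
    obtain ⟨ι⟩ := Cardinal.le_def _ _ |>.1 hle
    have : ∀ a, ∃ p ∈ (E ∩ cyl (w (ι a).1.down) n0), cyl p (nn (ι a).1.down) = ((ι a).2 : Set (ℕ → κ)) :=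
      fun a => (ι a).2.2
    choose p hp hpι using this
    refine ⟨p, fun a => nn (ι a).1.down, fun a => ⟨(hp a).1, ?_, ?_, ?_⟩, ?_⟩
    · exact mem_cyl_trans (hwP _).2 (cyl_anti _ (by simp [hn0]) (hp a).2)
    · exact le_trans (by simp [hn0]) (hnn _)
    · exact le_trans (by simp [hn0]) (hnn _)
    · intro y
      by_cases hy : ∃ i, y ∈ cyl (w i) n0
      · obtain ⟨i, hi⟩ := hy
        have key : ∀ a, (cyl y (nn i) ∩ cyl (p a) (nn (ι a).1.down)).Nonempty →
            (ι a).1.down = i ∧ ((ι a).2 : Set (ℕ → κ)) = cyl y (nn i) := by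
          rintro a ⟨z, hz, hza⟩
          have h1 : z ∈ cyl (w i) n0 := mem_cyl_trans hi (cyl_anti _ (hnn i) hz)
          have h2 : z ∈ cyl (w (ι a).1.down) n0 :=
            mem_cyl_trans (hp a).2 (cyl_anti _ (hnn _) hza)
          have h3 : (ι a).1.down = i := hwinj _ _ ((cyl_eq h2).symm.trans (cyl_eq h1))
          refine ⟨h3, ?_⟩
          rw [← hpι a, ← cyl_eq hza, h3, cyl_eq hz]
        refine ⟨nn i, fun a b ha hb => ?_⟩
        obtain ⟨ha1, ha2⟩ := key a ha
        obtain ⟨hb1, hb2⟩ := key b hb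
        apply ι.injective
        have h1 : (ι a).1 = (ι b).1 := ULift.ext _ _ (ha1.trans hb1.symm)
        have h2 : ((ι a).2 : Set (ℕ → κ)) = (ι b).2 := ha2.trans hb2.symm
        generalize ι a = A at h1 h2
        generalize ι b = B at h1 h2
        obtain ⟨A1, A2⟩ := A
        obtain ⟨B1, B2⟩ := B
        dsimp only at h1 h2
        subst h1
        congr
        exact Subtype.ext h2
      · refine ⟨n0, fun a b ha hb => ?_⟩
        obtain ⟨z, hz, hza⟩ := ha
        exact absurd ⟨_, mem_cyl_trans (mem_cyl_trans (hp a).2 (cyl_anti _ (hnn _) hza))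
          (mem_cyl_comm hz)⟩ hy

variable [TopologicalSpace κ] [DiscreteTopology κ]

theorem nest {T : ℕ → Set (ℕ → κ)} (hne : ∀ n, (T n).Nonempty) (hc : ∀ n, IsClosed (T n))
    (hanti : ∀ n, T (n+1) ⊆ T n) (hs : ∀ n, ∀ y ∈ T n, ∀ y' ∈ T n, ∀ c < n, y c = y' c) :
    ∃ y, ∀ n, y ∈ T n := by
  have hanti' : Antitone T := antitone_nat_of_succ_le hanti
  choose p hp using hne
  refine ⟨fun c => p (c+1) c, fun n => ?_⟩
  rw [← (hc n).closure_eq, mem_closure_cyl]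
  intro m
  refine ⟨p (max m n), hanti' (le_max_right _ _) (hp _), fun c hc => ?_⟩
  have : c + 1 ≤ max m n := le_trans hc (le_max_left _ _)
  exact hs (c+1) _ (hanti' this (hp _)) _ (hp _) c (Nat.lt_succ_self c)

theorem Thin.sm {Y T : Set (ℕ → κ)} (h : Thin T) : Sm Y Yᶜ T :=
  ⟨fun _ => T, fun _ => ∅, ∅, fun _ _ _ => ⟨0, h.mono inter_subset_left⟩,
    fun _ => ⟨IsGδ.empty, empty_subset _⟩, IsGδ.empty, empty_disjoint _,
    fun x hx => Or.inl (Or.inl (mem_iUnion.2 ⟨0, hx⟩))⟩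

/-- Validity of a stack. -/
def VV (F : ℕ → ℕ → Set (ℕ → κ)) (Y : Set (ℕ → κ)) (q : ℕ) (e : ℕ → Set (ℕ → κ) × ℕ)
    (T : Set (ℕ → κ)) (g : ℕ → ℕ) : Prop :=
  (∃ x m, T = cyl x m) ∧ ((e q).1 ∩ T).Nonempty ∧ (∀ j ≤ q, Kern F Y (e j).2 (e j).1) ∧
    ∀ j < q, (e (j+1)).1 ⊆ (e j).1 ∧ (∃ b, (e (j+1)).1 ⊆ F j b) ∧
      ∀ l < g j, Disjoint T (F (e j).2 l)

theorem VV.sub {F : ℕ → ℕ → Set (ℕ → κ)} {Y : Set (ℕ → κ)} {q : ℕ} {e : ℕ → Set (ℕ → κ) × ℕ}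
    {T : Set (ℕ → κ)} {g : ℕ → ℕ} (h : VV F Y q e T g) {j : ℕ} (hj : j ≤ q) :
    (e q).1 ⊆ (e j).1 := by
  obtain ⟨_, _, _, h4⟩ := h
  have : ∀ d, j + d ≤ q → (e (j + d)).1 ⊆ (e j).1 := by
    intro d
    induction d with
    | zero => exact fun _ => Subset.rfl
    | succ d ih => exact fun hd => ((h4 (j + d) (by omega)).1).trans (ih (by omega))
  have := this (q - j) (by omega)
  rwa [Nat.add_sub_cancel' hj] at this

theorem VV_step {F : ℕ → ℕ → Set (ℕ → κ)} {Y : Set (ℕ → κ)} (hF : ∀ n i, IsClosed (F n i))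
    (hY : Y = ⋂ n, ⋃ i, F n i) {i : ℕ} {e : ℕ → Set (ℕ → κ) × ℕ}
    {T : Set (ℕ → κ)} {g : ℕ → ℕ} (h : VV F Y i e T g) (g' : ℕ → ℕ) :
    ∃ e' T', T' ⊆ T ∧ VV F Y (i+1) e' T' g' ∧
      ∀ j ≤ i, (∀ j' < j, g' j' = g j') → e' j = e j := by
  have main : ∀ q ≤ i + 1, ∃ e' T', T' ⊆ T ∧ VV F Y q e' T' g' ∧
      ∀ j ≤ i, j ≤ q → (∀ j' < j, g' j' = g j') → e' j = e j := by
    intro q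
    induction q with
    | zero =>
      intro _
      refine ⟨e, T, Subset.rfl, ⟨h.1, ?_, fun j hj => h.2.2.1 j (by omega), fun j hj => by omega⟩,
        fun _ _ _ _ => rfl⟩
      obtain ⟨x, hx, hxT⟩ := h.2.1
      exact ⟨x, h.sub (Nat.zero_le _) hx, hxT⟩
    | succ q ih =>
      intro hq
      by_cases hc : q + 1 ≤ i ∧ ∀ j' < q + 1, g' j' = g j'
      · refine ⟨e, T, Subset.rfl, ⟨h.1, ?_, fun j hj => h.2.2.1 j (by omega), fun j hj => ?_⟩,
          fun _ _ _ _ => rfl⟩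
        · obtain ⟨x, hx, hxT⟩ := h.2.1
          exact ⟨x, h.sub hc.1 hx, hxT⟩
        · have := h.2.2.2 j (by omega)
          rwa [hc.2 j hj]
      · obtain ⟨e', T', hT', ⟨⟨x0, m0, rfl⟩, ⟨x, hxE, hxT⟩, hK, hL⟩, hag⟩ := ih (by omega)
        obtain ⟨x', m', n', E', hsub, hEE, hK', hne, hb, hav⟩ :=
          kern_step hF hY (hK q le_rfl) hxE m0 q (g' q)
        have hsub' : cyl x' m' ⊆ cyl x0 m0 := hsub.trans (cyl_eq hxT).subset
        refine ⟨Function.update e' (q+1) (E', n'), cyl x' m', hsub'.trans hT', ⟨⟨_, _, rfl⟩, ?_, ?_, ?_⟩, ?_⟩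
        · simpa using hne
        · intro j hj
          rcases eq_or_lt_of_le hj with rfl | hj
          · simpa using hK'
          · rw [Function.update_of_ne (by omega)]
            exact hK j (by omega)
        · intro j hj
          rw [Function.update_of_ne (show j ≠ q + 1 by omega)]
          rcases eq_or_lt_of_le (Nat.le_of_lt_succ hj) with rfl | hj
          · simp only [Function.update_self]
            exact ⟨hEE, hb, hav⟩
          · rw [Function.update_of_ne (show j + 1 ≠ q + 1 by omega)]
            obtain ⟨h1, h2, h3⟩ := hL j hj
            exact ⟨h1, h2, fun l hl => (h3 l hl).mono_left hsub'⟩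
        · intro j hji hjq hgg
          have hne : j ≠ q + 1 := by
            rintro rfl
            exact hc ⟨hji, hgg⟩
          rw [Function.update_of_ne hne]
          exact hag j hji (by omega) hgg
  obtain ⟨e', T', h1, h2, h3⟩ := main (i+1) le_rfl
  exact ⟨e', T', h1, h2, fun j hj => h3 j hj (by omega)⟩

theorem VV_next (hκ : Cardinal.aleph0 < Cardinal.mk κ)
    {F : ℕ → ℕ → Set (ℕ → κ)} {Y : Set (ℕ → κ)} (hF : ∀ n i, IsClosed (F n i))
    (hY : Y = ⋂ n, ⋃ i, F n i) {i : ℕ} {e : ℕ → Set (ℕ → κ) × ℕ}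
    {T : Set (ℕ → κ)} {g : ℕ → ℕ} (h : VV F Y i e T g) (g' : κ → ℕ → ℕ) :
    ∃ σ : κ → (ℕ → Set (ℕ → κ) × ℕ) × Set (ℕ → κ), (∀ a, (σ a).2 ⊆ T ∧
      VV F Y (i+1) (σ a).1 (σ a).2 (g' a) ∧
      (∀ j ≤ i, (∀ j' < j, g' a j' = g j') → (σ a).1 j = e j) ∧
      ∀ y ∈ (σ a).2, ∀ y' ∈ (σ a).2, ∀ c < i+1, y c = y' c) ∧
      ∀ y, ∃ m', ∀ a b, (cyl y m' ∩ (σ a).2).Nonempty → (cyl y m' ∩ (σ b).2).Nonempty → a = b := by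
  obtain ⟨⟨x0, m0, rfl⟩, ⟨x, hx, hxT⟩, hK, hL⟩ := h
  have hthin : ∀ x ∈ (e i).1, ∀ m, ¬ Thin ((e i).1 ∩ cyl x m) := fun x hx m hth =>
    ((hK i le_rfl).2.2 x hx m).1 hth.sm
  obtain ⟨p, q, hpq, hdisc⟩ := branch hκ hthin hx m0 (i+1)
  have hsub : ∀ a, cyl (p a) (q a) ⊆ cyl x0 m0 := fun a =>
    (cyl_subset (hpq a).2.1 (hpq a).2.2.1).trans (cyl_eq hxT).subset
  have hv : ∀ a, VV F Y i e (cyl (p a) (q a)) g := fun a =>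
    ⟨⟨_, _, rfl⟩, ⟨p a, (hpq a).1, mem_cyl_self _ _⟩, hK, fun j hj =>
      ⟨(hL j hj).1, (hL j hj).2.1, fun l hl => ((hL j hj).2.2 l hl).mono_left (hsub a)⟩⟩
  choose e' T' hT' hV' hag using fun a => VV_step hF hY (hv a) (g' a)
  refine ⟨fun a => (e' a, T' a), fun a => ⟨(hT' a).trans (hsub a), hV' a, hag a, ?_⟩, ?_⟩
  · intro y hy y' hy' c hc
    have hc' : c < q a := lt_of_lt_of_le hc (hpq a).2.2.2
    exact (hT' a hy c hc').trans (hT' a hy' c hc').symm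
  · intro y
    obtain ⟨m', hm'⟩ := hdisc y
    exact ⟨m', fun a b ha hb => hm' a b (ha.mono (inter_subset_inter_right _ (hT' a)))
      (hb.mono (inter_subset_inter_right _ (hT' b)))⟩

end PartTwo


section PartThree

set_option linter.unusedSectionVars false

variable {κ : Type u}

/-- The current guess. -/
noncomputable def gu (A : ℕ → ℕ → Set (ℕ → κ)) (s : List κ) (j : ℕ) : ℕ :=
  sInf {l | s.length ≤ l ∨ ∃ x, PiNat.res x s.length = s ∧ x ∈ A j l}

theorem mem_cyl_iff_res {x y : ℕ → κ} {n : ℕ} : y ∈ cyl x n ↔ PiNat.res y n = PiNat.res x n := by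
  rw [PiNat.res_eq_res]
  rfl

theorem gu_mono (A : ℕ → ℕ → Set (ℕ → κ)) (x : ℕ → κ) (j : ℕ) :
    Monotone fun n => gu A (PiNat.res x n) j := by
  apply monotone_nat_of_le_succ
  intro n
  unfold gu
  apply csInf_le_csInf (OrderBot.bddBelow _)
  · exact ⟨_, Or.inl le_rfl⟩
  · rintro l (hl | ⟨y, hy, hyl⟩)
    · left
      simp only [PiNat.res_length] at hl ⊢
      omega
    · right
      simp only [PiNat.res_length] at hy ⊢
      exact ⟨y, by simp only [PiNat.res_succ, List.cons.injEq] at hy; exact hy.2, hyl⟩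

theorem gu_le {A : ℕ → ℕ → Set (ℕ → κ)} {x : ℕ → κ} {j l : ℕ} (h : x ∈ A j l) (n : ℕ) :
    gu A (PiNat.res x n) j ≤ l :=
  Nat.sInf_le (Or.inr ⟨x, by rw [PiNat.res_length], h⟩)

theorem mono_bdd_const {f : ℕ → ℕ} (hf : Monotone f) {b : ℕ} (hb : ∀ n, f n ≤ b) :
    ∃ N, ∀ n ≥ N, f n = f N := by
  by_contra hcon
  push Not at hcon
  have : ∀ k, ∃ n, k ≤ f n := by
    intro k
    induction k with
    | zero => exact ⟨0, Nat.zero_le _⟩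
    | succ k ih =>
      obtain ⟨n, hn⟩ := ih
      obtain ⟨m, hm, hne⟩ := hcon n
      have := hf hm
      exact ⟨m, by omega⟩
  obtain ⟨n, hn⟩ := this (b+1)
  have := hb n
  omega

theorem gu_const {A : ℕ → ℕ → Set (ℕ → κ)} {x : ℕ → κ} (j : ℕ) (h : ∀ j' < j, ∃ l, x ∈ A j' l) :
    ∃ N, ∀ n ≥ N, ∀ j' < j, gu A (PiNat.res x n) j' = gu A (PiNat.res x N) j' := by
  induction j with
  | zero => exact ⟨0, fun _ _ _ h => by omega⟩
  | succ j ih =>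
    obtain ⟨N, hN⟩ := ih fun j' hj' => h j' (by omega)
    obtain ⟨l, hl⟩ := h j (by omega)
    obtain ⟨M, hM⟩ := mono_bdd_const (gu_mono A x j) (gu_le hl)
    refine ⟨max N M, fun n hn j' hj' => ?_⟩
    rcases eq_or_lt_of_le (Nat.le_of_lt_succ hj') with rfl | hj'
    · exact (hM n (by omega)).trans (hM _ (by omega)).symm
    · exact (hN n (by omega) j' hj').trans (hN _ (by omega) j' hj').symm

variable [TopologicalSpace κ] [DiscreteTopology κ]

theorem gu_unbdd {A : ℕ → ℕ → Set (ℕ → κ)} (hA : ∀ j l, IsClosed (A j l)) {x : ℕ → κ} {j : ℕ}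
    (h : ∀ l, x ∉ A j l) (L : ℕ) : ∃ N, ∀ n ≥ N, L ≤ gu A (PiNat.res x n) j := by
  have hW : IsOpen (⋂ i ∈ Finset.range L, (A j i)ᶜ) :=
    isOpen_biInter_finset fun i _ => (hA j i).isOpen_compl
  have hzW : x ∈ (⋂ i ∈ Finset.range L, (A j i)ᶜ) := by
    simp only [mem_iInter]
    exact fun i _ => h i
  obtain ⟨m, hm, hmW⟩ := exists_cyl_subset' hW hzW L
  refine ⟨m, fun n hn => le_trans ?_ (gu_mono A x j hn)⟩
  unfold gu
  refine le_csInf ⟨m, Or.inl (by rw [PiNat.res_length])⟩ ?_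
  rintro l (hl | ⟨y, hy, hyl⟩)
  · simp only [PiNat.res_length] at hl
    omega
  · simp only [PiNat.res_length] at hy
    by_contra hlt
    have := hmW (mem_cyl_iff_res.2 hy)
    simp only [mem_iInter] at this
    exact this l (Finset.mem_range.2 (by omega)) hyl

/-- The states of the construction. -/
abbrev HSt (κ : Type u) := (ℕ → Set (ℕ → κ) × ℕ) × Set (ℕ → κ)

theorem exists_states (hκ : Cardinal.aleph0 < Cardinal.mk κ)
    {F : ℕ → ℕ → Set (ℕ → κ)} {Y : Set (ℕ → κ)} (hF : ∀ n i, IsClosed (F n i))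
    (hY : Y = ⋂ n, ⋃ i, F n i) {E : Set (ℕ → κ)} (hEY : E ⊆ Y) (hE : ¬ Sm Y Yᶜ E)
    (G : List κ → ℕ → ℕ) :
    ∃ st : List κ → HSt κ, ((st []).1 0).1 ⊆ E ∧
      ∀ s, VV F Y s.length (st s).1 (st s).2 (G s) ∧
      (∀ a, (st (a :: s)).2 ⊆ (st s).2 ∧
        (∀ j ≤ s.length, (∀ j' < j, G (a :: s) j' = G s j') → (st (a :: s)).1 j = (st s).1 j) ∧
        ∀ y ∈ (st (a :: s)).2, ∀ y' ∈ (st (a :: s)).2, ∀ c < s.length+1, y c = y' c) ∧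
      ∀ y, ∃ m', ∀ a b, (cyl y m' ∩ (st (a :: s)).2).Nonempty →
        (cyl y m' ∩ (st (b :: s)).2).Nonempty → a = b := by
  classical
  obtain ⟨n, E', hE'E, hK⟩ := exists_kern hY hEY hE
  obtain ⟨x, hx⟩ := hK.2.1
  have H : ∀ (s : List κ) (σ : HSt κ), ∃ τ : κ → HSt κ, VV F Y s.length σ.1 σ.2 (G s) →
      (∀ a, (τ a).2 ⊆ σ.2 ∧
      VV F Y (s.length+1) (τ a).1 (τ a).2 (G (a :: s)) ∧
      (∀ j ≤ s.length, (∀ j' < j, G (a :: s) j' = G s j') → (τ a).1 j = σ.1 j) ∧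
      ∀ y ∈ (τ a).2, ∀ y' ∈ (τ a).2, ∀ c < s.length+1, y c = y' c) ∧
      ∀ y, ∃ m', ∀ a b, (cyl y m' ∩ (τ a).2).Nonempty → (cyl y m' ∩ (τ b).2).Nonempty → a = b := by
    intro s σ
    by_cases h : VV F Y s.length σ.1 σ.2 (G s)
    · obtain ⟨τ, hτ⟩ := VV_next hκ hF hY h (fun a => G (a :: s))
      exact ⟨τ, fun _ => hτ⟩
    · exact ⟨fun _ => σ, fun h' => absurd h' h⟩
  choose nx hnx using H
  let st : List κ → HSt κ := fun s =>
    List.rec (fun _ => (E', n), cyl x 0) (fun a s σ => nx s σ a) s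
  have hst : ∀ a s, st (a :: s) = nx s (st s) a := fun _ _ => rfl
  have hV : ∀ s, VV F Y s.length (st s).1 (st s).2 (G s) := by
    intro s
    induction s with
    | nil =>
      refine ⟨⟨x, 0, rfl⟩, ⟨x, hx, mem_cyl_self _ _⟩, fun j _ => hK, fun j hj => ?_⟩
      exact absurd hj (Nat.not_lt_zero _)
    | cons a s ih =>
      rw [hst]
      exact ((hnx s (st s) ih).1 a).2.1
  refine ⟨st, hE'E, fun s => ⟨hV s, fun a => ?_, ?_⟩⟩
  · rw [hst]
    obtain ⟨h1, _, h3, h4⟩ := (hnx s (st s) (hV s)).1 a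
    exact ⟨h1, h3, h4⟩
  · exact (hnx s (st s) (hV s)).2

theorem hurewicz (hκ : Cardinal.aleph0 < Cardinal.mk κ)
    {F : ℕ → ℕ → Set (ℕ → κ)} {Y : Set (ℕ → κ)} (hF : ∀ n i, IsClosed (F n i))
    (hY : Y = ⋂ n, ⋃ i, F n i) {E : Set (ℕ → κ)} (hEY : E ⊆ Y) (hE : ¬ Sm Y Yᶜ E)
    {A : ℕ → ℕ → Set (ℕ → κ)} (hA : ∀ j l, IsClosed (A j l)) :
    ∃ h : (ℕ → κ) → (ℕ → κ), IsClosedEmbedding h ∧ range h ⊆ closure E ∧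
      ∀ x, h x ∈ Y ↔ x ∈ ⋂ j, ⋃ l, A j l := by
  obtain ⟨st, h0, hst⟩ := exists_states hκ hF hY hEY hE (gu A)
  set T : (ℕ → κ) → ℕ → Set (ℕ → κ) := fun x n => (st (PiNat.res x n)).2 with hT
  have hVV : ∀ x n, VV F Y n (st (PiNat.res x n)).1 (T x n) (gu A (PiNat.res x n)) := by
    intro x n
    have := (hst (PiNat.res x n)).1
    rwa [PiNat.res_length] at this
  have hTanti : ∀ x n, T x (n+1) ⊆ T x n := fun x n => ((hst (PiNat.res x n)).2.1 (x n)).1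
  have hTcl : ∀ x n, IsClosed (T x n) := by
    intro x n
    obtain ⟨z, m, h⟩ := (hVV x n).1
    rw [h]
    exact isClosed_cyl z m
  have hTs : ∀ x n, ∀ y ∈ T x n, ∀ y' ∈ T x n, ∀ c < n, y c = y' c := by
    intro x n
    cases n with
    | zero => exact fun _ _ _ _ c hc => absurd hc (Nat.not_lt_zero _)
    | succ n =>
      have := ((hst (PiNat.res x n)).2.1 (x n)).2.2
      rw [PiNat.res_length] at this
      exact this
  have hTcongr : ∀ x x' n, PiNat.res x n = PiNat.res x' n → T x n = T x' n := by
    intro x x' n h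
    simp only [hT, h]
  have hne : ∀ x n, (T x n).Nonempty := fun x n =>
    let ⟨z, hz⟩ := (hVV x n).2.1; ⟨z, hz.2⟩
  choose h hh using fun x => nest (hne x) (hTcl x) (hTanti x) (hTs x)
  have hTanti' : ∀ x, Antitone (T x) := fun x => antitone_nat_of_succ_le (hTanti x)
  -- discreteness
  have hdisc : ∀ y n, ∃ M, ∀ x x', h x ∈ cyl y M → h x' ∈ cyl y M → PiNat.res x n = PiNat.res x' n := by
    intro y n
    by_contra hcon
    push Not at hcon
    have : ∀ k ≤ n, ∃ M, ∀ x x', h x ∈ cyl y M → h x' ∈ cyl y M → PiNat.res x k = PiNat.res x' k := by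
      intro k
      induction k with
      | zero => exact fun _ => ⟨0, fun _ _ _ _ => rfl⟩
      | succ k ih =>
        intro hk
        obtain ⟨M, hM⟩ := ih (by omega)
        obtain ⟨x0, x1, hx0, hx1, _⟩ := hcon M
        obtain ⟨m', hm'⟩ := (hst (PiNat.res x0 k)).2.2 y
        refine ⟨max M m', fun x x' hx hx' => ?_⟩
        have e1 := hM x x0 (cyl_anti y (le_max_left _ _) hx) hx0
        have e2 := hM x' x0 (cyl_anti y (le_max_left _ _) hx') hx0
        have := hm' (x k) (x' k) ⟨h x, cyl_anti y (le_max_right _ _) hx, by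
          rw [← e1, ← PiNat.res_succ]; exact hh x (k+1)⟩ ⟨h x', cyl_anti y (le_max_right _ _) hx', by
          rw [← e2, ← PiNat.res_succ]; exact hh x' (k+1)⟩
        rw [PiNat.res_succ, PiNat.res_succ, e1, e2, this]
    obtain ⟨M, hM⟩ := this n le_rfl
    obtain ⟨x, x', h1, h2, h3⟩ := hcon M
    exact h3 (hM x x' h1 h2)
  have hcyl : ∀ x x' n, x' ∈ cyl x n → h x' ∈ cyl (h x) n := by
    intro x x' n hx' c hc
    have : h x' ∈ T x n := by
      rw [hTcongr x x' n (mem_cyl_iff_res.1 hx').symm]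
      exact hh x' n
    exact hTs x n _ this _ (hh x n) c hc
  have hcont : Continuous h := by
    rw [continuous_def]
    intro O hO
    apply isOpen_of_cyl
    intro x hx
    obtain ⟨m, hm⟩ := exists_cyl_subset hO hx
    exact ⟨m, fun x' hx' => hm (hcyl x x' m hx')⟩
  have hinj : Function.Injective h := by
    intro x x' hxx
    apply PiNat.res_injective
    funext n
    obtain ⟨M, hM⟩ := hdisc (h x) n
    exact hM x x' (mem_cyl_self _ _) (by rw [hxx]; exact mem_cyl_self _ _)
  have hclosed : IsClosedMap h := by
    intro K hK
    apply isClosed_of_closure_subset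
    intro y hy
    rw [mem_closure_cyl] at hy
    choose M hM using hdisc y
    set M' : ℕ → ℕ := fun n => n + ∑ i ∈ Finset.range (n+1), M i with hM'
    have hMM' : ∀ n, M n ≤ M' n := fun n => by
      have := Finset.single_le_sum (f := M) (fun i _ => Nat.zero_le _) (Finset.self_mem_range_succ n)
      simp only [hM']
      omega
    have hM'mono : ∀ n, M' n ≤ M' (n+1) := fun n => by
      simp only [hM']
      rw [Finset.sum_range_succ _ (n+1)]
      omega
    obtain ⟨x, hx⟩ := nest (T := fun n => closure {x | x ∈ K ∧ h x ∈ cyl y (M' n)})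
      (fun n => by
        obtain ⟨_, ⟨x, hxK, rfl⟩, hx⟩ := hy (M' n)
        exact ⟨x, subset_closure ⟨hxK, hx⟩⟩) (fun n => isClosed_closure)
      (fun n => closure_mono fun x hx => ⟨hx.1, cyl_anti y (hM'mono n) hx.2⟩)
      (by
        intro n z hz z' hz' c hc
        obtain ⟨w, hw, hwz⟩ := mem_closure_cyl.1 hz n
        obtain ⟨w', hw', hwz'⟩ := mem_closure_cyl.1 hz' n
        have := hM n w w' (cyl_anti y (hMM' n) hw.2) (cyl_anti y (hMM' n) hw'.2)
        rw [← hwz c hc, ← hwz' c hc]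
        exact PiNat.res_eq_res.1 this hc)
    refine ⟨x, ?_, ?_⟩
    · rw [← hK.closure_eq]
      exact closure_mono (fun z hz => hz.1) (hx 0)
    · funext c
      obtain ⟨w, hw, hwx⟩ := mem_closure_cyl.1 (hx (c+1)) (c+1)
      rw [← hcyl x w (c+1) hwx c (Nat.lt_succ_self c)]
      exact hw.2 c (by simp only [hM']; omega)
  have he : ∀ x (j N : ℕ), j ≤ N → (∀ n ≥ N, ∀ j' < j, gu A (PiNat.res x n) j' = gu A (PiNat.res x N) j') →
      ∀ n ≥ N, (st (PiNat.res x n)).1 j = (st (PiNat.res x N)).1 j := by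
    intro x j N hjN hN n hn
    induction n, hn using Nat.le_induction with
    | base => rfl
    | succ n hn ih =>
      rw [← ih]
      have := ((hst (PiNat.res x n)).2.1 (x n)).2.1 j (by rw [PiNat.res_length]; omega)
      apply this
      intro j' hj'
      rw [← PiNat.res_succ, hN (n+1) (by omega) j' hj', hN n hn j' hj']
  have hcl : ∀ x (C : Set (ℕ → κ)) N, (∀ n ≥ N, ((st (PiNat.res x n)).1 n).1 ⊆ C) → h x ∈ closure C := by
    intro x C N hC
    rw [mem_closure_cyl]
    intro m
    obtain ⟨z, hz, hzT⟩ := (hVV x (max m N)).2.1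
    refine ⟨z, hC _ (le_max_right _ _) hz, fun c hc => ?_⟩
    exact hTs x _ _ hzT _ (hh x _) c (lt_of_lt_of_le hc (le_max_left _ _))
  refine ⟨h, IsClosedEmbedding.of_continuous_injective_isClosedMap hcont hinj hclosed, ?_, ?_⟩
  · rintro _ ⟨x, rfl⟩
    apply closure_mono h0
    apply hcl x _ 0
    intro n _
    have := he x 0 0 le_rfl (fun _ _ _ h => absurd h (Nat.not_lt_zero _)) n (Nat.zero_le _)
    rw [PiNat.res_zero] at this
    rw [← this]
    exact (hVV x n).sub (Nat.zero_le _)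
  · intro x
    constructor
    · intro hxY
      by_contra hcon
      simp only [mem_iInter, mem_iUnion, not_forall, not_exists] at hcon
      classical
      let j := Nat.find hcon
      have hj : ∀ l, x ∉ A j l := Nat.find_spec hcon
      have hlt : ∀ j' < j, ∃ l, x ∈ A j' l := by
        intro j' hj'
        have := Nat.find_min hcon hj'
        push Not at this
        exact this
      obtain ⟨N0, hN0⟩ := gu_const j hlt
      obtain ⟨N, hN, hjN⟩ : ∃ N, N0 ≤ N ∧ j ≤ N := ⟨max N0 j, le_max_left _ _, le_max_right _ _⟩
      have hc := he x j N hjN (fun n hn j' hj' =>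
        (hN0 n (by omega) j' hj').trans (hN0 N hN j' hj').symm)
      rw [hY] at hxY
      obtain ⟨l, hl⟩ := mem_iUnion.1 (mem_iInter.1 hxY ((st (PiNat.res x N)).1 j).2)
      obtain ⟨M, hM⟩ := gu_unbdd hA hj (l+1)
      set n := max (N+1) M with hn
      have h1 := ((hVV x n).2.2.2 j (by omega)).2.2 l (hM n (by omega))
      rw [hc n (by omega)] at h1
      exact Set.disjoint_left.1 h1 (hh x n) hl
    · intro hx
      rw [hY]
      simp only [mem_iInter, mem_iUnion] at hx ⊢
      intro j
      obtain ⟨N0, hN0⟩ := gu_const (j+1) (fun j' _ => hx j')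
      obtain ⟨N, hN, hjN⟩ : ∃ N, N0 ≤ N ∧ j + 1 ≤ N := ⟨max N0 (j+1), le_max_left _ _, le_max_right _ _⟩
      have hc := he x (j+1) N hjN (fun n hn j' hj' =>
        (hN0 n (by omega) j' hj').trans (hN0 N hN j' hj').symm)
      obtain ⟨b, hb⟩ := ((hVV x N).2.2.2 j (by omega)).2.1
      refine ⟨b, ?_⟩
      rw [← (hF j b).closure_eq]
      apply hcl x _ N
      intro n hn
      refine Subset.trans ?_ hb
      rw [← hc n hn]
      exact (hVV x n).sub (by omega)

end PartThree


section PartFour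

set_option linter.unusedSectionVars false

variable {κ : Type u} [TopologicalSpace κ] [DiscreteTopology κ]

theorem locallyWeightLT_of_inducing {Z : Type u} [TopologicalSpace Z] {e : Z → ℕ → κ}
    (he : IsInducing e) {S : Set (ℕ → κ)} (hS : LW S) (heS : ∀ z, e z ∈ S) :
    LocallyWeightLT Z (Cardinal.mk κ) := by
  intro z
  obtain ⟨m, hm⟩ := hS (e z) (heS z)
  refine ⟨e ⁻¹' cyl (e z) m, ((isOpen_cyl _ _).preimage he.continuous).mem_nhds (mem_cyl_self _ _), ?_⟩
  have he' : IsInducing fun w : ↥(e ⁻¹' cyl (e z) m) => e w.1 := he.comp IsInducing.subtypeVal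
  refine ⟨(fun C => (fun w : ↥(e ⁻¹' cyl (e z) m) => e w.1) ⁻¹' C) ''
    (⋃ n, nodes (S ∩ cyl (e z) m) n), ?_, Cardinal.mk_image_le.trans_lt hm⟩
  apply TopologicalSpace.isTopologicalBasis_of_isOpen_of_nhds
  · rintro _ ⟨C, hC, rfl⟩
    obtain ⟨n, x, _, rfl⟩ := mem_iUnion.1 hC
    exact (isOpen_cyl _ _).preimage he'.continuous
  · intro w O hw hO
    obtain ⟨O', hO', rfl⟩ := he'.isOpen_iff.1 hO
    obtain ⟨n, hn⟩ := exists_cyl_subset hO' hw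
    refine ⟨_, ⟨cyl (e w.1) n, mem_iUnion.2 ⟨n, e w.1, ⟨heS _, w.2⟩, rfl⟩, rfl⟩, mem_cyl_self _ _, ?_⟩
    exact preimage_mono hn

theorem gdelta_range {Z Y' : Type*} [TopologicalSpace Z] [TopologicalSpace Y']
    [TopologicalSpace.MetrizableSpace Y'] {e : Z → ℕ → κ} (he : IsInducing e)
    (hG : IsGδ (range e)) {φ : Z → Y'} (hφ : IsInducing φ) : IsGδ (range φ) := by
  obtain ⟨O, hO, hGO⟩ := isGδ_iff_eq_iInter_nat.1 hG
  let W : ℕ → Set Y' := fun n => ⋃₀ {W | IsOpen W ∧ ∃ x l, n ≤ l ∧ cyl x l ⊆ O n ∧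
    φ ⁻¹' W ⊆ e ⁻¹' (cyl x l)}
  have hW : ∀ n, IsOpen (W n) := fun n => isOpen_sUnion fun W hW => hW.1
  have key : range φ = closure (range φ) ∩ ⋂ n, W n := by
    apply Subset.antisymm
    · rintro _ ⟨z, rfl⟩
      refine ⟨subset_closure ⟨z, rfl⟩, mem_iInter.2 fun n => ?_⟩
      have hz : e z ∈ O n := by
        have : e z ∈ ⋂ n, O n := hGO ▸ ⟨z, rfl⟩
        exact mem_iInter.1 this n
      obtain ⟨l, hl, hlO⟩ := exists_cyl_subset' (hO n) hz n
      obtain ⟨W', hW', hWe⟩ := hφ.isOpen_iff.1 ((isOpen_cyl (e z) l).preimage he.continuous)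
      refine ⟨W', ⟨hW', e z, l, hl, hlO, hWe.subset⟩, ?_⟩
      have : z ∈ φ ⁻¹' W' := by rw [hWe]; exact mem_cyl_self _ _
      exact this
    · rintro y ⟨hy, hyW⟩
      have h1 : ∀ n, ∃ W', y ∈ W' ∧ IsOpen W' ∧ ∃ x l, n ≤ l ∧ cyl x l ⊆ O n ∧
          φ ⁻¹' W' ⊆ e ⁻¹' (cyl x l) := by
        intro n
        obtain ⟨W', h, hyW'⟩ := mem_iInter.1 hyW n
        exact ⟨W', hyW', h⟩
      choose W' hyW' hW'o x l hl hlO hWe using h1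
      have h2 : ∀ (N : Set Y'), IsOpen N → y ∈ N → ∀ n, ∃ z, φ z ∈ N ∧ ∀ i ≤ n, e z ∈ cyl (x i) (l i) := by
        intro N hN hyN n
        have ho : IsOpen (N ∩ ⋂ i ∈ Finset.range (n+1), W' i) :=
          hN.inter (isOpen_biInter_finset fun i _ => hW'o i)
        obtain ⟨_, hw, z, rfl⟩ := mem_closure_iff.1 hy _ ho ⟨hyN, by
          simp only [mem_iInter]; exact fun i _ => hyW' i⟩
        refine ⟨z, hw.1, fun i hi => ?_⟩
        have := hw.2
        simp only [mem_iInter] at this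
        exact hWe i (this i (Finset.mem_range.2 (by omega)))
      obtain ⟨p, hp⟩ := nest (T := fun n => {w | ∀ i ≤ n, w ∈ cyl (x i) (l i)})
        (fun n => by
          obtain ⟨z, _, hz⟩ := h2 univ isOpen_univ (mem_univ _) n
          exact ⟨e z, hz⟩)
        (fun n => by
          have : {w | ∀ i ≤ n, w ∈ cyl (x i) (l i)} = ⋂ i, ⋂ (_ : i ≤ n), cyl (x i) (l i) := by
            ext w; simp
          rw [this]
          exact isClosed_iInter fun i => isClosed_iInter fun _ => isClosed_cyl _ _)
        (fun n w hw i hi => hw i (by omega))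
        (fun n w hw w' hw' c hc => by
          have h := hl n
          rw [hw n le_rfl c (by omega), hw' n le_rfl c (by omega)])
      have hpx : ∀ n, p ∈ cyl (x n) (l n) := fun n => hp n n le_rfl
      have hpG : p ∈ range e := by
        rw [hGO]
        exact mem_iInter.2 fun n => hlO n (hpx n)
      obtain ⟨z, rfl⟩ := hpG
      refine ⟨z, ?_⟩
      by_contra hne
      obtain ⟨N', N, hN', hN, hzN', hyN, hdis⟩ := t2_separation hne
      obtain ⟨Q, hQ, hQe⟩ := he.isOpen_iff.1 (hN'.preimage hφ.continuous)
      have hzQ : e z ∈ Q := by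
        have : z ∈ e ⁻¹' Q := by rw [hQe]; exact hzN'
        exact this
      obtain ⟨m, hm⟩ := exists_cyl_subset hQ hzQ
      obtain ⟨z', hz'N, hz'⟩ := h2 N hN hyN m
      have h3 : e z' ∈ cyl (e z) m := by
        have := mem_cyl_trans (mem_cyl_comm (hpx m)) (hz' m le_rfl)
        exact cyl_anti _ (hl m) this
      have h4 : z' ∈ φ ⁻¹' N' := by rw [← hQe]; exact hm h3
      exact Set.disjoint_left.1 hdis h4 hz'N
  rw [key]
  letI := TopologicalSpace.metrizableSpaceMetric Y'
  exact isClosed_closure.isGδ.inter (IsGδ.iInter_of_isOpen hW)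

theorem absGdeltaSigma_of {Z : Type u} [TopologicalSpace Z] {e : Z → ℕ → κ} (he : IsEmbedding e)
    {G : ℕ → Set (ℕ → κ)} (hG : ∀ n, IsGδ (G n)) (hr : range e = ⋃ n, G n) : AbsGdeltaSigma Z := by
  refine ⟨he.metrizableSpace, fun Y _ _ φ hφ => ⟨fun n => range fun z : ↥(e ⁻¹' G n) => φ z.1, ?_, ?_⟩⟩
  · intro n
    refine gdelta_range (e := fun z : ↥(e ⁻¹' G n) => e z.1)
      (he.isInducing.comp IsInducing.subtypeVal) ?_ (hφ.isInducing.comp IsInducing.subtypeVal)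
    have : range (fun z : ↥(e ⁻¹' G n) => e z.1) = G n := by
      apply Subset.antisymm
      · rintro _ ⟨z, rfl⟩
        exact z.2
      · intro y hy
        have : y ∈ range e := hr ▸ mem_iUnion.2 ⟨n, hy⟩
        obtain ⟨z, rfl⟩ := this
        exact ⟨⟨z, hy⟩, rfl⟩
    rw [this]
    exact hG n
  · apply Subset.antisymm
    · rintro _ ⟨z, rfl⟩
      have : e z ∈ ⋃ n, G n := hr ▸ ⟨z, rfl⟩
      obtain ⟨n, hn⟩ := mem_iUnion.1 this
      exact mem_iUnion.2 ⟨n, ⟨z, hn⟩, rfl⟩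
    · intro y hy
      obtain ⟨n, z, rfl⟩ := mem_iUnion.1 hy
      exact ⟨z.1, rfl⟩

theorem not_sm_of_nowhere {X : Set (ℕ → κ)} (hd : Dense X)
    (hn : NowhereSLWplusGDS ↥X (Cardinal.mk κ)) {O : Set (ℕ → κ)} (hO : IsOpen O)
    (hne : O.Nonempty) : ¬ Sm X Xᶜ (X ∩ O) := by
  rintro ⟨S, T, H, h1, h2, h3, h4, h5⟩
  have hHX : H ⊆ X := disjoint_compl_right_iff_subset.1 h4
  obtain ⟨p, hpO, hpX⟩ := hd.inter_open_nonempty O hO hne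
  apply hn (Subtype.val ⁻¹' O) (hO.preimage continuous_subtype_val) ⟨⟨p, hpX⟩, hpO⟩
  let e : ↥(Subtype.val ⁻¹' O : Set ↥X) → ℕ → κ := fun u => u.1.1
  have he : IsEmbedding e := IsEmbedding.subtypeVal.comp IsEmbedding.subtypeVal
  refine ⟨{u | e u ∈ ⋃ n, S n}, {u | e u ∈ (⋃ n, T n) ∪ H}, ?_, ?_, ?_⟩
  · apply eq_univ_of_forall
    intro u
    rcases h5 ⟨u.1.2, u.2⟩ with (h | h) | h
    · exact Or.inl h
    · exact Or.inr (Or.inl h)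
    · exact Or.inr (Or.inr h)
  · refine ⟨fun n => {a | e a.1 ∈ S n}, ?_, fun n => ?_⟩
    · apply eq_univ_of_forall
      intro a
      obtain ⟨n, hn⟩ := mem_iUnion.1 a.2
      exact mem_iUnion.2 ⟨n, hn⟩
    · exact locallyWeightLT_of_inducing (e := fun b => e b.1.1)
        (he.isInducing.comp (IsInducing.subtypeVal.comp IsInducing.subtypeVal)) (h1 n) (fun b => b.2)
  · refine absGdeltaSigma_of (e := fun b => e b.1) (he.comp IsEmbedding.subtypeVal)
      (G := fun n => Nat.rec (H ∩ O) (fun m _ => T m ∩ O) n) ?_ ?_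
    · intro n
      cases n with
      | zero => exact h3.inter hO.isGδ
      | succ n => exact (h2 n).1.inter hO.isGδ
    · apply Subset.antisymm
      · rintro _ ⟨b, rfl⟩
        rcases b.2 with h | h
        · obtain ⟨n, hn⟩ := mem_iUnion.1 h
          exact mem_iUnion.2 ⟨n+1, hn, b.1.2⟩
        · exact mem_iUnion.2 ⟨0, h, b.1.2⟩
      · intro y hy
        obtain ⟨n, hn⟩ := mem_iUnion.1 hy
        cases n with
        | zero => exact ⟨⟨⟨⟨y, hHX hn.1⟩, hn.2⟩, Or.inr hn.1⟩, rfl⟩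
        | succ n => exact ⟨⟨⟨⟨y, (h2 n).2 hn.1⟩, hn.2⟩, Or.inl (mem_iUnion.2 ⟨n, hn.1⟩)⟩, rfl⟩

theorem exists_nwd_cover {X : Set (ℕ → κ)} (hc : FirstCategory ↥X) :
    ∃ K : ℕ → Set (ℕ → κ), (∀ n, IsClosed (K n) ∧ IsNowhereDense (K n)) ∧ X ⊆ ⋃ n, K n := by
  obtain ⟨S, hS, hSc, hSU⟩ := isMeagre_iff_countable_union_isNowhereDense.1 hc
  obtain ⟨s, hs⟩ := (hSc.insert (∅ : Set ↥X)).exists_eq_range (insert_nonempty _ _)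
  refine ⟨fun n => closure (Subtype.val '' s n), fun n => ⟨isClosed_closure, ?_⟩, ?_⟩
  · have : s n ∈ insert ∅ S := hs ▸ ⟨n, rfl⟩
    have h : IsNowhereDense (s n) := by
      rcases this with h | h
      · rw [h]; exact isNowhereDense_empty
      · exact hS _ h
    exact h.image_val.closure
  · intro x hx
    obtain ⟨t, ht, hxt⟩ := hSU (mem_univ (⟨x, hx⟩ : ↥X))
    have : t ∈ range s := hs ▸ Or.inr ht
    obtain ⟨n, rfl⟩ := this
    exact mem_iUnion.2 ⟨n, subset_closure ⟨_, hxt, rfl⟩⟩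

theorem exists_F {X : Set (ℕ → κ)} (h : IsFsigmaDelta X) :
    ∃ F : ℕ → ℕ → Set (ℕ → κ), (∀ n i, IsClosed (F n i)) ∧ X = ⋂ n, ⋃ i, F n i := by
  obtain ⟨G, hG, hX⟩ := h
  choose F hF hGF using hG
  exact ⟨F, hF, by rw [hX]; exact iInter_congr hGF⟩

/-- The data extracted from the hypotheses on `X`. -/
structure Good (X : Set (ℕ → κ)) (K : ℕ → Set (ℕ → κ)) : Prop where
  clK : ∀ n, IsClosed (K n)
  nwd : ∀ n, IsNowhereDense (K n)
  cov : X ⊆ ⋃ n, K n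
  fsd : ∃ F : ℕ → ℕ → Set (ℕ → κ), (∀ n i, IsClosed (F n i)) ∧ X = ⋂ n, ⋃ i, F n i
  emb : ∀ V : Set (ℕ → κ), IsOpen V → V.Nonempty →
    ∀ A : ℕ → ℕ → Set (ℕ → κ), (∀ j l, IsClosed (A j l)) →
    ∃ h : (ℕ → κ) → (ℕ → κ), IsClosedEmbedding h ∧ range h ⊆ V ∧ IsNowhereDense (range h) ∧
      ∀ x, h x ∈ X ↔ x ∈ ⋂ j, ⋃ l, A j l

theorem exists_good (hκ : Cardinal.aleph0 < Cardinal.mk κ) {X : Set (ℕ → κ)} (hd : Dense X)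
    (hf : IsFsigmaDelta X) (hc : FirstCategory ↥X)
    (hn : NowhereSLWplusGDS ↥X (Cardinal.mk κ)) : ∃ K, Good X K := by
  obtain ⟨K, hK, hXK⟩ := exists_nwd_cover hc
  obtain ⟨F, hF, hXF⟩ := exists_F hf
  refine ⟨K, fun n => (hK n).1, fun n => (hK n).2, hXK, ⟨F, hF, hXF⟩, ?_⟩
  intro V hV ⟨x, hx⟩ A hA
  obtain ⟨m, hm⟩ := exists_cyl_subset hV hx
  have hns := not_sm_of_nowhere hd hn (isOpen_cyl x m) ⟨x, mem_cyl_self _ _⟩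
  have : ∃ i, ¬ Sm X Xᶜ (X ∩ cyl x m ∩ K i) := by
    by_contra hcon
    push Not at hcon
    apply hns
    refine (Sm.iUnion hcon).mono ?_
    intro y hy
    obtain ⟨i, hi⟩ := mem_iUnion.1 (hXK hy.1)
    exact mem_iUnion.2 ⟨i, hy, hi⟩
  obtain ⟨i, hi⟩ := this
  obtain ⟨h, h1, h2, h3⟩ := hurewicz hκ hF hXF (fun y hy => hy.1.1) hi hA
  have h4 : closure (X ∩ cyl x m ∩ K i) ⊆ cyl x m ∩ K i :=
    closure_minimal (fun y hy => ⟨hy.1.2, hy.2⟩) ((isClosed_cyl x m).inter (hK i).1)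
  refine ⟨h, h1, fun y hy => hm (h4 (h2 hy)).1, (hK i).2.mono fun y hy => (h4 (h2 hy)).2, h3⟩

end PartFour


section PartFive

set_option linter.unusedSectionVars false

variable {κ : Type u} [TopologicalSpace κ] [DiscreteTopology κ]

theorem exists_retract {P : Set (ℕ → κ)} (hP : IsClosed P) :
    ∃ r : (ℕ → κ) → (ℕ → κ), Continuous r ∧ (∀ x ∈ P, r x = x) ∧
      ∀ x m, (∃ p ∈ P, p ∈ cyl x m) → r x ∈ P ∧ r x ∈ cyl x m := by
  by_cases hne : P.Nonempty
  · obtain ⟨f, hfix, hrange, hlip⟩ := PiNat.exists_lipschitz_retraction_of_isClosed hP hne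
    let _ : MetricSpace (ℕ → κ) := PiNat.metricSpace (E := fun _ => κ)
    refine ⟨f, hlip.continuous, hfix, ?_⟩
    rintro x m ⟨p, hp, hpx⟩
    refine ⟨hrange ▸ ⟨x, rfl⟩, ?_⟩
    have h1 : dist p x ≤ (1 / 2) ^ m := PiNat.mem_cylinder_iff_dist_le.1 hpx
    have h2 : dist (f x) p ≤ (1 / 2) ^ m := by
      have := hlip.dist_le_mul x p
      rw [hfix p hp, NNReal.coe_one, one_mul, dist_comm x p] at this
      exact this.trans h1
    have h3 : f x ∈ cyl p m := PiNat.mem_cylinder_iff_dist_le.2 h2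
    exact mem_cyl_trans hpx h3
  · rw [not_nonempty_iff_eq_empty] at hne
    subst hne
    exact ⟨id, continuous_id, fun x hx => hx.elim, fun x m ⟨p, hp, _⟩ => hp.elim⟩

theorem clopen_of_loc {S : Set (ℕ → κ)} (h : ∀ x, ∃ m, ∀ y ∈ cyl x m, (y ∈ S ↔ x ∈ S)) :
    IsClopen S := by
  constructor
  · constructor
    apply isOpen_of_cyl
    intro x hx
    obtain ⟨m, hm⟩ := h x
    exact ⟨m, fun y hy hyS => hx ((hm y hy).1 hyS)⟩
  · apply isOpen_of_cyl
    intro x hx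
    obtain ⟨m, hm⟩ := h x
    exact ⟨m, fun y hy => (hm y hy).2 hx⟩

theorem loc_of_clopen {S : Set (ℕ → κ)} (hS : IsClopen S) (x : ℕ → κ) (N : ℕ) :
    ∃ m, N ≤ m ∧ ∀ y ∈ cyl x m, (y ∈ S ↔ x ∈ S) := by
  by_cases hx : x ∈ S
  · obtain ⟨m, hNm, hm⟩ := exists_cyl_subset' hS.isOpen hx N
    exact ⟨m, hNm, fun y hy => ⟨fun _ => hx, fun _ => hm hy⟩⟩
  · obtain ⟨m, hNm, hm⟩ := exists_cyl_subset' hS.compl.isOpen hx N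
    exact ⟨m, hNm, fun y hy => ⟨fun h => absurd h (hm hy), fun h => absurd h hx⟩⟩

/-- Points which are `m`-close to `P`. -/
def Near (P : Set (ℕ → κ)) (m : ℕ) : Set (ℕ → κ) := {x | ∃ p ∈ P, p ∈ cyl x m}

theorem near_congr {P : Set (ℕ → κ)} {m : ℕ} {x y : ℕ → κ} (h : y ∈ cyl x m) :
    y ∈ Near P m ↔ x ∈ Near P m := by
  unfold Near
  simp only [mem_ofPred_eq, cyl_eq h]

/-- The cells near `P`. -/
def cell (U P : Set (ℕ → κ)) (r g : (ℕ → κ) → (ℕ → κ)) (m : ℕ) (s t : Set (ℕ → κ)) :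
    Set (ℕ → κ) := {x | x ∈ U ∧ x ∈ Near P m ∧ cyl x m = s ∧ cyl (g (r x)) m = t}

theorem cell_clopen {U P : Set (ℕ → κ)} {r g : (ℕ → κ) → (ℕ → κ)} {m : ℕ} (s t : Set (ℕ → κ))
    (hU : IsClopen U) (hr : Continuous r)
    (hrP : ∀ x m, (∃ p ∈ P, p ∈ cyl x m) → r x ∈ P ∧ r x ∈ cyl x m) (hg : ContinuousOn g P) :
    IsClopen (cell U P r g m s t) := by
  apply clopen_of_loc
  intro x
  obtain ⟨m1, hm1, hU1⟩ := loc_of_clopen hU x m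
  by_cases hx : x ∈ Near P m
  · obtain ⟨O, hO, hOP⟩ := continuousOn_iff'.1 hg _ (isOpen_cyl (g (r x)) m)
    have hrx := (hrP x m hx).1
    have hxO : r x ∈ O := by
      have : r x ∈ O ∩ P := by
        rw [← hOP]
        exact ⟨mem_cyl_self _ _, hrx⟩
      exact this.1
    obtain ⟨m2, hm2, hm2O⟩ := exists_cyl_subset' (hO.preimage hr) hxO m1
    refine ⟨m2, fun y hy => ?_⟩
    have hym : y ∈ cyl x m := cyl_anti x (hm1.trans hm2) hy
    have h1 := near_congr (P := P) hym
    have h2 := hU1 y (cyl_anti x hm2 hy)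
    have h3 : g (r y) ∈ cyl (g (r x)) m := by
      have : r y ∈ g ⁻¹' cyl (g (r x)) m ∩ P := by
        rw [hOP]
        exact ⟨hm2O hy, (hrP y m (h1.2 hx)).1⟩
      exact this.1
    unfold cell
    simp only [mem_ofPred_eq, h1, h2, cyl_eq hym, cyl_eq h3]
  · refine ⟨m, fun y hy => ?_⟩
    have h1 := near_congr (P := P) hy
    exact ⟨fun h => absurd (h1.1 h.2.1) hx, fun h => absurd h.2.1 hx⟩

/-- States of the back-and-forth construction. -/
structure BS (κ : Type u) where
  U : Set (ℕ → κ)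
  V : Set (ℕ → κ)
  P : Set (ℕ → κ)
  Q : Set (ℕ → κ)
  g : (ℕ → κ) → (ℕ → κ)
  g' : (ℕ → κ) → (ℕ → κ)
  j : ℕ

/-- Validity of a state. -/
structure Valid (X₁ X₂ : Set (ℕ → κ)) (K L : ℕ → Set (ℕ → κ)) (σ : BS κ) : Prop where
  hU : IsClopen σ.U
  hV : IsClopen σ.V
  hUn : σ.U.Nonempty
  hVn : σ.V.Nonempty
  hP : IsClosed σ.P
  hQ : IsClosed σ.Q
  hPU : σ.P ⊆ σ.U
  hQV : σ.Q ⊆ σ.V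
  hPn : IsNowhereDense σ.P
  hQn : IsNowhereDense σ.Q
  hg : ContinuousOn σ.g σ.P
  hg' : ContinuousOn σ.g' σ.Q
  hgm : MapsTo σ.g σ.P σ.Q
  hgm' : MapsTo σ.g' σ.Q σ.P
  hgg : ∀ x ∈ σ.P, σ.g' (σ.g x) = x
  hgg' : ∀ y ∈ σ.Q, σ.g (σ.g' y) = y
  hX : ∀ x ∈ σ.P, x ∈ X₁ ↔ σ.g x ∈ X₂
  hK : ∀ i, 2 * i < σ.j → K i ∩ σ.U ⊆ σ.P
  hL : ∀ i, 2 * i + 1 < σ.j → L i ∩ σ.V ⊆ σ.Q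

theorem core {X₁ X₂ : Set (ℕ → κ)} {K L : ℕ → Set (ℕ → κ)} (h1 : Good X₁ K) (h2 : Good X₂ L)
    {P V : Set (ℕ → κ)} (hP : IsClosed P) (hV : IsOpen V) (hVn : V.Nonempty) :
    ∃ (Q : Set (ℕ → κ)) (g g' : (ℕ → κ) → (ℕ → κ)), IsClosed Q ∧ Q ⊆ V ∧ IsNowhereDense Q ∧
      ContinuousOn g P ∧ ContinuousOn g' Q ∧ MapsTo g P Q ∧ MapsTo g' Q P ∧
      (∀ x ∈ P, g' (g x) = x) ∧ (∀ y ∈ Q, g (g' y) = y) ∧ ∀ x ∈ P, x ∈ X₁ ↔ g x ∈ X₂ := by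
  obtain ⟨F, hF, hXF⟩ := h1.fsd
  obtain ⟨h, he, hr, hn, hX⟩ := h2.emb V hV hVn (fun j l => F j l ∩ P) fun j l => (hF j l).inter hP
  have : Nonempty (ℕ → κ) := hVn.to_type
  have hinv : ∀ x, Function.invFun h (h x) = x := Function.leftInverse_invFun he.injective
  refine ⟨h '' P, h, Function.invFun h, he.isClosedMap _ hP, (image_subset_range _ _).trans hr,
    hn.mono (image_subset_range _ _), he.continuous.continuousOn, ?_, mapsTo_image _ _, ?_,
    fun x _ => hinv x, ?_, ?_⟩
  · rw [he.isInducing.continuousOn_iff]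
    apply continuousOn_id.congr
    rintro _ ⟨x, _, rfl⟩
    simp only [Function.comp, hinv, id]
  · rintro _ ⟨x, hx, rfl⟩
    rwa [hinv]
  · rintro _ ⟨x, hx, rfl⟩
    rw [hinv]
  · intro x hx
    rw [hX, hXF]
    simp only [mem_iInter, mem_iUnion, mem_inter_iff, hx, and_true]

theorem newstate {X₁ X₂ : Set (ℕ → κ)} {K L : ℕ → Set (ℕ → κ)} (h1 : Good X₁ K) (h2 : Good X₂ L)
    {U V : Set (ℕ → κ)} (hU : IsClopen U) (hUn : U.Nonempty) (hV : IsClopen V) (hVn : V.Nonempty)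
    (j : ℕ) (hK : ∀ i, 2 * i < j → ∀ x ∈ K i, x ∉ U) (hL : ∀ i, 2 * i + 1 < j → ∀ x ∈ L i, x ∉ V) :
    ∃ c : BS κ, Valid X₁ X₂ K L c ∧ c.U = U ∧ c.V = V ∧ c.j = j + 1 := by
  rcases Nat.even_or_odd' j with ⟨i, rfl | rfl⟩
  · have hP : IsClosed (K i ∩ U) := (h1.clK i).inter hU.isClosed
    obtain ⟨Q, g, g', a1, a2, a3, a4, a5, a6, a7, a8, a9, a10⟩ := core h1 h2 hP hV.isOpen hVn
    refine ⟨⟨U, V, K i ∩ U, Q, g, g', 2 * i + 1⟩, ⟨hU, hV, hUn, hVn, hP, a1, inter_subset_right, a2,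
      (h1.nwd i).mono inter_subset_left, a3, a4, a5, a6, a7, a8, a9, a10, ?_, ?_⟩, rfl, rfl, rfl⟩
    · rintro i' hi' x ⟨hx, hxU⟩
      dsimp only at hi' hxU ⊢
      rcases eq_or_ne i' i with rfl | hne
      · exact ⟨hx, hxU⟩
      · exact absurd hxU (hK i' (by omega) x hx)
    · rintro i' hi' x ⟨hx, hxV⟩
      dsimp only at hi' hxV
      exact absurd hxV (hL i' (by omega) x hx)
  · have hQ : IsClosed (L i ∩ V) := (h2.clK i).inter hV.isClosed
    obtain ⟨P, g, g', a1, a2, a3, a4, a5, a6, a7, a8, a9, a10⟩ := core h2 h1 hQ hU.isOpen hUn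
    refine ⟨⟨U, V, P, L i ∩ V, g', g, 2 * i + 1 + 1⟩, ⟨hU, hV, hUn, hVn, a1, hQ, a2, inter_subset_right,
      a3, (h2.nwd i).mono inter_subset_left, a5, a4, a7, a6, a9, a8, ?_, ?_, ?_⟩, rfl, rfl, rfl⟩
    · intro x hx
      have := a10 _ (a7 hx)
      rw [a9 x hx] at this
      exact this.symm
    · rintro i' hi' x ⟨hx, hxU⟩
      dsimp only at hi' hxU
      exact absurd hxU (hK i' (by omega) x hx)
    · rintro i' hi' x ⟨hx, hxV⟩
      dsimp only at hi' hxV ⊢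
      rcases eq_or_ne i' i with rfl | hne
      · exact ⟨hx, hxV⟩
      · exact absurd hxV (hL i' (by omega) x hx)

/-- `c` is a child of `σ` at stage `n`. -/
structure Child (X₁ X₂ : Set (ℕ → κ)) (K L : ℕ → Set (ℕ → κ)) (n : ℕ) (σ c : BS κ) : Prop where
  valid : Valid X₁ X₂ K L c
  hU : c.U ⊆ σ.U
  hV : c.V ⊆ σ.V
  sU : ∀ x ∈ c.U, ∀ x' ∈ c.U, x' ∈ cyl x n
  sV : ∀ x ∈ c.V, ∀ x' ∈ c.V, x' ∈ cyl x n
  alt : (c.j = σ.j ∧ c.g = σ.g ∧ c.P = σ.P ∩ c.U ∧ ∀ x ∈ c.U, ∃ p ∈ σ.P, p ∈ cyl x n) ∨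
    (c.j = σ.j + 1 ∧ Disjoint c.U σ.P ∧ Disjoint c.V σ.Q)

theorem card_nodes (hκ : Cardinal.aleph0 < Cardinal.mk κ) {R : Set (ℕ → κ)} (hR : IsOpen R)
    (hne : R.Nonempty) : ∃ m0, ∀ m ≥ m0, Cardinal.mk (nodes R m) = Cardinal.mk κ := by
  classical
  obtain ⟨x, hx⟩ := hne
  obtain ⟨a, ha⟩ := exists_cyl_subset hR hx
  refine ⟨a + 1, fun m hm => le_antisymm ?_ ?_⟩
  · have : nodes R m ⊆ range fun l : List κ => {y | PiNat.res y m = l} := by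
      rintro _ ⟨z, _, rfl⟩
      refine ⟨PiNat.res z m, ?_⟩
      ext y
      exact mem_cyl_iff_res.symm
    have : Infinite κ := Cardinal.infinite_iff.2 hκ.le
    exact (Cardinal.mk_le_mk_of_subset ‹nodes R m ⊆ _›).trans
      (Cardinal.mk_range_le.trans (Cardinal.mk_list_eq_mk κ).le)
  · have hmem : ∀ b, Function.update x a b ∈ R := fun b => ha fun c hc => by
      rw [Function.update_of_ne (by omega)]
    refine Cardinal.mk_le_of_injective (f := fun b =>
      (⟨cyl (Function.update x a b) m, _, hmem b, rfl⟩ : nodes R m)) ?_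
    intro b b' hbb
    have h1 : cyl (Function.update x a b) m = cyl (Function.update x a b') m :=
      congrArg Subtype.val hbb
    have h2 : Function.update x a b ∈ cyl (Function.update x a b') m := by
      rw [← h1]; exact mem_cyl_self _ _
    simpa using h2 a (by omega)

theorem exists_far {U P : Set (ℕ → κ)} (hU : IsOpen U) (hUn : U.Nonempty) (hP : IsClosed P)
    (hPn : IsNowhereDense P) : ∃ m0, ∀ m ≥ m0, (U \ Near P m).Nonempty := by
  have : ∃ x ∈ U, x ∉ P := by
    by_contra hcon
    push Not at hcon
    obtain ⟨x, hx⟩ := hUn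
    have h1 : x ∈ interior (closure P) :=
      interior_maximal (fun y hy => subset_closure (hcon y hy)) hU hx
    rw [hPn] at h1
    exact h1
  obtain ⟨x, hxU, hxP⟩ := this
  obtain ⟨m, hm⟩ := exists_cyl_subset hP.isOpen_compl hxP
  refine ⟨m, fun m' hm' => ⟨x, hxU, ?_⟩⟩
  rintro ⟨p, hp, hpx⟩
  exact hm (cyl_anti x hm' hpx) hp

theorem far_clopen {U : Set (ℕ → κ)} (hU : IsClopen U) (P : Set (ℕ → κ)) (m : ℕ) :
    IsClopen (U \ Near P m) := by
  have : IsClopen (Near P m) := clopen_of_loc fun x => ⟨m, fun y hy => near_congr hy⟩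
  exact IsClopen.diff hU this

theorem cyl_clopen (x : ℕ → κ) (m : ℕ) : IsClopen (cyl x m) := ⟨isClosed_cyl x m, isOpen_cyl x m⟩

theorem cell_transfer {V P Q : Set (ℕ → κ)} {g r' g' : (ℕ → κ) → (ℕ → κ)} {m : ℕ}
    {s t : Set (ℕ → κ)} (hQV : Q ⊆ V)
    (hrQ : ∀ x ∈ Q, r' x = x)
    (hgm : MapsTo g P Q) (hgg : ∀ x ∈ P, g' (g x) = x) {p : ℕ → κ} (hp : p ∈ P)
    (hs : cyl p m = s) (ht : cyl (g p) m = t) : g p ∈ cell V Q r' g' m t s :=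
  ⟨hQV (hgm hp), ⟨g p, hgm hp, mem_cyl_self _ _⟩, ht, by rw [hrQ _ (hgm hp), hgg p hp, hs]⟩

end PartFive


section PartSix

set_option linter.unusedSectionVars false

variable {κ : Type u} [TopologicalSpace κ] [DiscreteTopology κ]

theorem step (hκ : Cardinal.aleph0 < Cardinal.mk κ) {X₁ X₂ : Set (ℕ → κ)}
    {K L : ℕ → Set (ℕ → κ)} (h1 : Good X₁ K) (h2 : Good X₂ L) {σ : BS κ}
    (hσ : Valid X₁ X₂ K L σ) (n : ℕ) :
    ∃ C : Set (BS κ), (∀ c ∈ C, Child X₁ X₂ K L n σ c) ∧ (∀ x ∈ σ.U, ∃ c ∈ C, x ∈ c.U) ∧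
      (∀ y ∈ σ.V, ∃ c ∈ C, y ∈ c.V) ∧
      (∀ c ∈ C, ∀ c' ∈ C, ∀ x, x ∈ c.U → x ∈ c'.U → c = c') ∧
      (∀ c ∈ C, ∀ c' ∈ C, ∀ y, y ∈ c.V → y ∈ c'.V → c = c') := by
  obtain ⟨r, hr, hrP, hrN⟩ := exists_retract hσ.hP
  obtain ⟨r', hr', hrQ, hrN'⟩ := exists_retract hσ.hQ
  obtain ⟨m0, hm0⟩ := exists_far hσ.hU.isOpen hσ.hUn hσ.hP hσ.hPn
  obtain ⟨m1, hm1⟩ := exists_far hσ.hV.isOpen hσ.hVn hσ.hQ hσ.hQn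
  obtain ⟨m, hnm, hm0m, hm1m⟩ : ∃ m, n ≤ m ∧ m0 ≤ m ∧ m1 ≤ m :=
    ⟨max n (max m0 m1), by simp, by simp, by simp⟩
  have hRUn := hm0 m hm0m
  have hRVn := hm1 m hm1m
  set RU := σ.U \ Near σ.P m with hRU
  set RV := σ.V \ Near σ.Q m with hRV
  have hRUc : IsClopen RU := far_clopen hσ.hU _ _
  have hRVc : IsClopen RV := far_clopen hσ.hV _ _
  obtain ⟨m2, hm2⟩ := card_nodes hκ hRUc.isOpen hRUn
  obtain ⟨m3, hm3⟩ := card_nodes hκ hRVc.isOpen hRVn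
  obtain ⟨q, hnq, hq2, hq3⟩ : ∃ q, n ≤ q ∧ m2 ≤ q ∧ m3 ≤ q :=
    ⟨max n (max m2 m3), by simp, by simp, by simp⟩
  obtain ⟨β⟩ := Cardinal.eq.1 ((hm2 q hq2).trans (hm3 q hq3).symm)
  have hPN : ∀ x ∈ σ.P, x ∈ Near σ.P m := fun x hx => ⟨x, hx, mem_cyl_self _ _⟩
  have hQN : ∀ x ∈ σ.Q, x ∈ Near σ.Q m := fun x hx => ⟨x, hx, mem_cyl_self _ _⟩
  have hnew : ∀ D : nodes RU q, ∃ c : BS κ, Valid X₁ X₂ K L c ∧ c.U = D.1 ∩ RU ∧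
      c.V = (β D).1 ∩ RV ∧ c.j = σ.j + 1 := by
    intro D
    obtain ⟨x, hx, hxD⟩ := D.2
    obtain ⟨y, hy, hyD⟩ := (β D).2
    dsimp only at hxD hyD
    apply newstate h1 h2
    · rw [← hxD]
      exact (cyl_clopen _ _).inter hRUc
    · exact ⟨x, hxD ▸ mem_cyl_self _ _, hx⟩
    · rw [← hyD]
      exact (cyl_clopen _ _).inter hRVc
    · exact ⟨y, hyD ▸ mem_cyl_self _ _, hy⟩
    · intro i hi z hz hzU
      exact hzU.2.2 (hPN z (hσ.hK i hi ⟨hz, hzU.2.1⟩))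
    · intro i hi z hz hzU
      exact hzU.2.2 (hQN z (hσ.hL i hi ⟨hz, hzU.2.1⟩))
  choose c2 hc2v hc2U hc2V hc2j using hnew
  let c1 : Set (ℕ → κ) → Set (ℕ → κ) → BS κ := fun s t =>
    ⟨cell σ.U σ.P r σ.g m s t, cell σ.V σ.Q r' σ.g' m t s, σ.P ∩ cell σ.U σ.P r σ.g m s t,
      σ.Q ∩ cell σ.V σ.Q r' σ.g' m t s, σ.g, σ.g', σ.j⟩
  have tr1 : ∀ x s t, x ∈ cell σ.U σ.P r σ.g m s t → r x ∈ σ.P ∧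
      σ.g (r x) ∈ cell σ.V σ.Q r' σ.g' m t s := by
    rintro x s t ⟨hxU, hxN, hxs, hxt⟩
    obtain ⟨ha, hb⟩ := hrN x m hxN
    exact ⟨ha, cell_transfer hσ.hQV hrQ hσ.hgm hσ.hgg ha ((cyl_eq hb).trans hxs) hxt⟩
  have tr2 : ∀ y s t, y ∈ cell σ.V σ.Q r' σ.g' m t s → r' y ∈ σ.Q ∧
      σ.g' (r' y) ∈ cell σ.U σ.P r σ.g m s t := by
    rintro x s t ⟨hxU, hxN, hxs, hxt⟩
    obtain ⟨ha, hb⟩ := hrN' x m hxN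
    exact ⟨ha, cell_transfer hσ.hPU hrP hσ.hgm' hσ.hgg' ha ((cyl_eq hb).trans hxs) hxt⟩
  have hc1 : ∀ s t, (c1 s t).U.Nonempty → Child X₁ X₂ K L n σ (c1 s t) := by
    rintro s t ⟨x, hx⟩
    have cU : IsClopen (c1 s t).U := cell_clopen s t hσ.hU hr hrN hσ.hg
    have cV : IsClopen (c1 s t).V := cell_clopen t s hσ.hV hr' hrN' hσ.hg'
    refine ⟨⟨cU, cV, ⟨x, hx⟩, ⟨_, (tr1 x s t hx).2⟩, hσ.hP.inter cU.isClosed, hσ.hQ.inter cV.isClosed,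
      inter_subset_right, inter_subset_right, hσ.hPn.mono inter_subset_left,
      hσ.hQn.mono inter_subset_left, hσ.hg.mono inter_subset_left, hσ.hg'.mono inter_subset_left,
      ?_, ?_, fun x hx => hσ.hgg x hx.1, fun x hx => hσ.hgg' x hx.1, fun x hx => hσ.hX x hx.1, ?_, ?_⟩,
      fun x hx => hx.1, fun x hx => hx.1, ?_, ?_, Or.inl ⟨rfl, rfl, rfl, ?_⟩⟩
    · rintro p ⟨hp, hpc⟩
      refine ⟨hσ.hgm hp, ?_⟩
      have := (tr1 p s t hpc).2
      rwa [hrP p hp] at this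
    · rintro p ⟨hp, hpc⟩
      refine ⟨hσ.hgm' hp, ?_⟩
      have := (tr2 p s t hpc).2
      rwa [hrQ p hp] at this
    · rintro i hi z ⟨hz, hzU⟩
      exact ⟨hσ.hK i hi ⟨hz, hzU.1⟩, hzU⟩
    · rintro i hi z ⟨hz, hzU⟩
      exact ⟨hσ.hL i hi ⟨hz, hzU.1⟩, hzU⟩
    · intro z hz z' hz'
      apply cyl_anti z hnm
      rw [hz.2.2.1, ← hz'.2.2.1]
      exact mem_cyl_self _ _
    · intro z hz z' hz'
      apply cyl_anti z hnm
      rw [hz.2.2.1, ← hz'.2.2.1]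
      exact mem_cyl_self _ _
    · intro z hz
      obtain ⟨p, hp, hpz⟩ := hz.2.1
      exact ⟨p, hp, cyl_anti z hnm hpz⟩
  have hc2 : ∀ D, Child X₁ X₂ K L n σ (c2 D) := by
    intro D
    obtain ⟨x, hx, hxD⟩ := D.2
    obtain ⟨y, hy, hyD⟩ := (β D).2
    dsimp only at hxD hyD
    refine ⟨hc2v D, ?_, ?_, ?_, ?_, Or.inr ⟨hc2j D, ?_, ?_⟩⟩
    · rw [hc2U]
      exact fun z hz => hz.2.1
    · rw [hc2V]
      exact fun z hz => hz.2.1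
    · rw [hc2U, ← hxD]
      exact fun z hz z' hz' => cyl_anti z hnq (mem_cyl_trans (mem_cyl_comm hz.1) hz'.1)
    · rw [hc2V, ← hyD]
      exact fun z hz z' hz' => cyl_anti z hnq (mem_cyl_trans (mem_cyl_comm hz.1) hz'.1)
    · rw [hc2U, Set.disjoint_left]
      exact fun z hz hzP => hz.2.2 (hPN z hzP)
    · rw [hc2V, Set.disjoint_left]
      exact fun z hz hzP => hz.2.2 (hQN z hzP)
  have nodeU : ∀ (D : nodes RU q) x, x ∈ D.1 → D.1 = cyl x q := by
    intro D x hx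
    obtain ⟨z, hz, hzD⟩ := D.2
    dsimp only at hzD
    rw [← hzD] at hx ⊢
    exact (cyl_eq hx).symm
  have nodeV : ∀ (D : nodes RV q) x, x ∈ D.1 → D.1 = cyl x q := by
    intro D x hx
    obtain ⟨z, hz, hzD⟩ := D.2
    dsimp only at hzD
    rw [← hzD] at hx ⊢
    exact (cyl_eq hx).symm
  refine ⟨{c | ∃ s t, c = c1 s t ∧ (c1 s t).U.Nonempty} ∪ range c2, ?_, ?_, ?_, ?_, ?_⟩
  · rintro c (⟨s, t, rfl, hne⟩ | ⟨D, rfl⟩)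
    · exact hc1 s t hne
    · exact hc2 D
  · intro x hx
    by_cases hN : x ∈ Near σ.P m
    · have hmem : x ∈ (c1 (cyl x m) (cyl (σ.g (r x)) m)).U := ⟨hx, hN, rfl, rfl⟩
      exact ⟨_, Or.inl ⟨_, _, rfl, ⟨x, hmem⟩⟩, hmem⟩
    · have hxR : x ∈ RU := ⟨hx, hN⟩
      refine ⟨c2 ⟨cyl x q, x, hxR, rfl⟩, Or.inr ⟨_, rfl⟩, ?_⟩
      rw [hc2U]
      exact ⟨mem_cyl_self _ _, hxR⟩
  · intro y hy
    by_cases hN : y ∈ Near σ.Q m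
    · have hmem : y ∈ (c1 (cyl (σ.g' (r' y)) m) (cyl y m)).V := ⟨hy, hN, rfl, rfl⟩
      exact ⟨_, Or.inl ⟨_, _, rfl, ⟨_, (tr2 _ _ _ hmem).2⟩⟩, hmem⟩
    · have hxR : y ∈ RV := ⟨hy, hN⟩
      refine ⟨c2 (β.symm ⟨cyl y q, y, hxR, rfl⟩), Or.inr ⟨_, rfl⟩, ?_⟩
      rw [hc2V, Equiv.apply_symm_apply]
      exact ⟨mem_cyl_self _ _, hxR⟩
  · rintro c (⟨s, t, rfl, hne⟩ | ⟨D, rfl⟩) c' (⟨s', t', rfl, hne'⟩ | ⟨D', rfl⟩) x hx hx'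
    · obtain ⟨_, _, rfl, rfl⟩ := hx
      obtain ⟨_, _, rfl, rfl⟩ := hx'
      rfl
    · rw [hc2U] at hx'
      exact absurd hx.2.1 hx'.2.2
    · rw [hc2U] at hx
      exact absurd hx'.2.1 hx.2.2
    · rw [hc2U] at hx hx'
      congr 1
      exact Subtype.ext ((nodeU D x hx.1).trans (nodeU D' x hx'.1).symm)
  · rintro c (⟨s, t, rfl, hne⟩ | ⟨D, rfl⟩) c' (⟨s', t', rfl, hne'⟩ | ⟨D', rfl⟩) x hx hx'
    · obtain ⟨_, _, rfl, rfl⟩ := hx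
      obtain ⟨_, _, rfl, rfl⟩ := hx'
      rfl
    · rw [hc2V] at hx'
      exact absurd hx.2.1 hx'.2.2
    · rw [hc2V] at hx
      exact absurd hx'.2.1 hx.2.2
    · rw [hc2V] at hx hx'
      congr 1
      apply β.injective
      exact Subtype.ext ((nodeV _ x hx.1).trans (nodeV _ x hx'.1).symm)

theorem exists_limit_map {S R : (ℕ → κ) → ℕ → Set (ℕ → κ)} (hxS : ∀ x n, x ∈ S x n)
    (hS : ∀ x n, IsOpen (S x n)) (hRn : ∀ x n, (R x n).Nonempty) (hRc : ∀ x n, IsClosed (R x n))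
    (hRa : ∀ x n, R x (n+1) ⊆ R x n)
    (hRs : ∀ x n, ∀ y ∈ R x (n+1), ∀ y' ∈ R x (n+1), y' ∈ cyl y n)
    (hSR : ∀ x n, ∀ x' ∈ S x n, R x' n = R x n) :
    ∃ f : (ℕ → κ) → (ℕ → κ), Continuous f ∧ ∀ x n, f x ∈ R x n := by
  have : ∀ x, ∃ y, ∀ n, y ∈ R x (n+1) := fun x =>
    nest (T := fun n => R x (n+1)) (fun n => hRn x _) (fun n => hRc x _) (fun n => hRa x _)
      (fun n y hy y' hy' c hc => hRs x n y' hy' y hy c hc)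
  choose f hf using this
  refine ⟨f, ?_, fun x n => hRa x n (hf x n)⟩
  rw [continuous_def]
  intro O hO
  rw [isOpen_iff_forall_mem_open]
  intro x hx
  obtain ⟨m, hm⟩ := exists_cyl_subset hO hx
  refine ⟨S x (m+1), fun x' hx' => ?_, hS x _, hxS x _⟩
  have h1 := hf x' m
  rw [hSR x _ x' hx'] at h1
  exact hm (hRs x m _ (hf x m) _ h1)

theorem mainB (hκ : Cardinal.aleph0 < Cardinal.mk κ) {X₁ X₂ : Set (ℕ → κ)}
    {K L : ℕ → Set (ℕ → κ)} (h1 : Good X₁ K) (h2 : Good X₂ L) :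
    ∃ f : (ℕ → κ) ≃ₜ (ℕ → κ), f '' X₁ = X₂ := by
  classical
  have hne : Nonempty κ := by
    rw [← Cardinal.mk_ne_zero_iff]
    intro h
    rw [h] at hκ
    exact absurd hκ (not_lt.2 (by simp))
  have H : ∀ (n : ℕ) (σ : BS κ), ∃ C : Set (BS κ), Valid X₁ X₂ K L σ →
      (∀ c ∈ C, Child X₁ X₂ K L n σ c) ∧ (∀ x ∈ σ.U, ∃ c ∈ C, x ∈ c.U) ∧
      (∀ y ∈ σ.V, ∃ c ∈ C, y ∈ c.V) ∧
      (∀ c ∈ C, ∀ c' ∈ C, ∀ x, x ∈ c.U → x ∈ c'.U → c = c') ∧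
      (∀ c ∈ C, ∀ c' ∈ C, ∀ y, y ∈ c.V → y ∈ c'.V → c = c') := by
    intro n σ
    by_cases hσ : Valid X₁ X₂ K L σ
    · obtain ⟨C, hC⟩ := step hκ h1 h2 hσ n
      exact ⟨C, fun _ => hC⟩
    · exact ⟨∅, fun h => absurd h hσ⟩
  choose C hC using H
  let root : BS κ := ⟨univ, univ, ∅, ∅, id, id, 0⟩
  have hroot : Valid X₁ X₂ K L root :=
    ⟨isClopen_univ, isClopen_univ, univ_nonempty, univ_nonempty, isClosed_empty, isClosed_empty,
      empty_subset _, empty_subset _, isNowhereDense_empty, isNowhereDense_empty,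
      continuousOn_empty _, continuousOn_empty _, mapsTo_empty _ _, mapsTo_empty _ _,
      fun x hx => hx.elim, fun x hx => hx.elim, fun x hx => hx.elim,
      fun i hi => absurd hi (Nat.not_lt_zero _), fun i hi => absurd hi (Nat.not_lt_zero _)⟩
  haveI : Nonempty (BS κ) := ⟨root⟩
  let s : (ℕ → κ) → ℕ → BS κ := fun x n => Nat.rec root
    (fun n σ => Classical.epsilon fun c => c ∈ C n σ ∧ x ∈ c.U) n
  let t : (ℕ → κ) → ℕ → BS κ := fun y n => Nat.rec root
    (fun n σ => Classical.epsilon fun c => c ∈ C n σ ∧ y ∈ c.V) n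
  have hs1 : ∀ x n, s x (n+1) = Classical.epsilon fun c => c ∈ C n (s x n) ∧ x ∈ c.U :=
    fun _ _ => rfl
  have ht1 : ∀ x n, t x (n+1) = Classical.epsilon fun c => c ∈ C n (t x n) ∧ x ∈ c.V :=
    fun _ _ => rfl
  have hs : ∀ x n, Valid X₁ X₂ K L (s x n) ∧ x ∈ (s x n).U ∧ s x (n+1) ∈ C n (s x n) ∧
      x ∈ (s x (n+1)).U := by
    intro x n
    induction n with
    | zero =>
      have := Classical.epsilon_spec ((hC 0 root hroot).2.1 x (mem_univ x))
      exact ⟨hroot, mem_univ x, this.1, this.2⟩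
    | succ n ih =>
      obtain ⟨a, b, c, d⟩ := ih
      have hv := ((hC n _ a).1 _ c).valid
      have := Classical.epsilon_spec ((hC (n+1) _ hv).2.1 x d)
      exact ⟨hv, d, this.1, this.2⟩
  have ht : ∀ x n, Valid X₁ X₂ K L (t x n) ∧ x ∈ (t x n).V ∧ t x (n+1) ∈ C n (t x n) ∧
      x ∈ (t x (n+1)).V := by
    intro x n
    induction n with
    | zero =>
      have := Classical.epsilon_spec ((hC 0 root hroot).2.2.1 x (mem_univ x))
      exact ⟨hroot, mem_univ x, this.1, this.2⟩
    | succ n ih =>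
      obtain ⟨a, b, c, d⟩ := ih
      have hv := ((hC n _ a).1 _ c).valid
      have := Classical.epsilon_spec ((hC (n+1) _ hv).2.2.1 x d)
      exact ⟨hv, d, this.1, this.2⟩
  have chs : ∀ x n, Child X₁ X₂ K L n (s x n) (s x (n+1)) := fun x n =>
    (hC n _ (hs x n).1).1 _ (hs x n).2.2.1
  have cht : ∀ x n, Child X₁ X₂ K L n (t x n) (t x (n+1)) := fun x n =>
    (hC n _ (ht x n).1).1 _ (ht x n).2.2.1
  have ess : ∀ x n, ∀ x' ∈ (s x n).U, s x' n = s x n := by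
    intro x n
    induction n with
    | zero => exact fun _ _ => rfl
    | succ n ih =>
      intro x' hx'
      have e := ih x' ((chs x n).hU hx')
      have hm := (hs x' n).2.2.1
      rw [e] at hm
      exact (hC n _ (hs x n).1).2.2.2.1 _ hm _ (hs x n).2.2.1 x' (hs x' n).2.2.2 hx'
  have ets : ∀ x n, ∀ y ∈ (s x n).V, t y n = s x n := by
    intro x n
    induction n with
    | zero => exact fun _ _ => rfl
    | succ n ih =>
      intro x' hx'
      have e := ih x' ((chs x n).hV hx')
      have hm := (ht x' n).2.2.1
      rw [e] at hm
      exact (hC n _ (hs x n).1).2.2.2.2 _ hm _ (hs x n).2.2.1 x' (ht x' n).2.2.2 hx'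
  have ett : ∀ x n, ∀ x' ∈ (t x n).V, t x' n = t x n := by
    intro x n
    induction n with
    | zero => exact fun _ _ => rfl
    | succ n ih =>
      intro x' hx'
      have e := ih x' ((cht x n).hV hx')
      have hm := (ht x' n).2.2.1
      rw [e] at hm
      exact (hC n _ (ht x n).1).2.2.2.2 _ hm _ (ht x n).2.2.1 x' (ht x' n).2.2.2 hx'
  have est : ∀ x n, ∀ y ∈ (t x n).U, s y n = t x n := by
    intro x n
    induction n with
    | zero => exact fun _ _ => rfl
    | succ n ih =>
      intro x' hx'
      have e := ih x' ((cht x n).hU hx')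
      have hm := (hs x' n).2.2.1
      rw [e] at hm
      exact (hC n _ (ht x n).1).2.2.2.1 _ hm _ (ht x n).2.2.1 x' (hs x' n).2.2.2 hx'
  obtain ⟨f, hfc, hf⟩ := exists_limit_map (S := fun x n => (s x n).U) (R := fun x n => (s x n).V)
    (fun x n => (hs x n).2.1) (fun x n => (hs x n).1.hU.isOpen) (fun x n => (hs x n).1.hVn)
    (fun x n => (hs x n).1.hV.isClosed) (fun x n => (chs x n).hV) (fun x n => (chs x n).sV)
    (fun x n x' hx' => by rw [ess x n x' hx'])
  obtain ⟨f', hfc', hf'⟩ := exists_limit_map (S := fun x n => (t x n).V) (R := fun x n => (t x n).U)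
    (fun x n => (ht x n).2.1) (fun x n => (ht x n).1.hV.isOpen) (fun x n => (ht x n).1.hUn)
    (fun x n => (ht x n).1.hU.isClosed) (fun x n => (cht x n).hU) (fun x n => (cht x n).sU)
    (fun x n x' hx' => by rw [ett x n x' hx'])
  have hff : ∀ x, f' (f x) = x := by
    intro x
    funext c
    have h := hf' (f x) (c+1+1)
    rw [ets x (c+1+1) (f x) (hf x (c+1+1))] at h
    exact (chs x (c+1)).sU _ (hs x (c+1+1)).2.1 _ h c (Nat.lt_succ_self c)
  have hff' : ∀ x, f (f' x) = x := by
    intro x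
    funext c
    have h := hf (f' x) (c+1+1)
    rw [est x (c+1+1) (f' x) (hf' x (c+1+1))] at h
    exact (cht x (c+1)).sV _ (ht x (c+1+1)).2.1 _ h c (Nat.lt_succ_self c)
  have hX : ∀ x, x ∈ X₁ ↔ f x ∈ X₂ := by
    intro x
    have jmono : Monotone fun n => (s x n).j := by
      apply monotone_nat_of_le_succ
      intro n
      rcases (chs x n).alt with h | h
      · exact h.1.ge
      · rw [h.1]; exact Nat.le_succ _
    by_cases hb : ∃ b, ∀ n, (s x n).j ≤ b
    · obtain ⟨b, hb⟩ := hb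
      obtain ⟨N, hN⟩ := mono_bdd_const jmono hb
      have hi : ∀ n ≥ N, (s x (n+1)).g = (s x n).g ∧ (s x (n+1)).P = (s x n).P ∩ (s x (n+1)).U ∧
          ∃ p ∈ (s x n).P, p ∈ cyl x n := by
        intro n hn
        rcases (chs x n).alt with h | h
        · exact ⟨h.2.1, h.2.2.1, h.2.2.2 x (hs x (n+1)).2.1⟩
        · have e1 := hN n hn
          have e2 := hN (n+1) (by omega)
          have e3 := h.1
          omega
      have hg : ∀ n ≥ N, (s x n).g = (s x N).g ∧ (s x n).P ⊆ (s x N).P := by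
        intro n hn
        induction n, hn using Nat.le_induction with
        | base => exact ⟨rfl, Subset.rfl⟩
        | succ n hn ih =>
          obtain ⟨a, b, _⟩ := hi n hn
          exact ⟨a.trans ih.1, by rw [b]; exact inter_subset_left.trans ih.2⟩
      have hxP : x ∈ (s x N).P := by
        rw [← (hs x N).1.hP.closure_eq, mem_closure_cyl]
        intro m
        obtain ⟨p, hp, hpx⟩ := (hi (max m N) (le_max_right _ _)).2.2
        exact ⟨p, (hg _ (le_max_right _ _)).2 hp, cyl_anti x (le_max_left _ _) hpx⟩
      have hxPn : ∀ n ≥ N, x ∈ (s x n).P := by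
        intro n hn
        induction n, hn using Nat.le_induction with
        | base => exact hxP
        | succ n hn ih =>
          rw [(hi n hn).2.1]
          exact ⟨ih, (hs x (n+1)).2.1⟩
      have hfg : f x = (s x N).g x := by
        funext c
        have hn : max (c+1) N + 1 ≥ N := by omega
        have h3 := (hs x (max (c+1) N + 1)).1.hQV ((hs x (max (c+1) N + 1)).1.hgm (hxPn _ hn))
        rw [(hg _ hn).1] at h3
        exact (chs x (max (c+1) N)).sV _ h3 _ (hf x (max (c+1) N + 1)) c (by omega)
      rw [hfg]
      exact (hs x N).1.hX x hxP
    · push Not at hb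
      have hjump : ∀ N, ∃ n ≥ N, (s x (n+1)).j = (s x n).j + 1 ∧
          Disjoint (s x (n+1)).U (s x n).P ∧ Disjoint (s x (n+1)).V (s x n).Q := by
        intro N
        by_contra hcon
        have : ∀ n ≥ N, (s x n).j = (s x N).j := by
          intro n hn
          induction n, hn using Nat.le_induction with
          | base => rfl
          | succ n hn ih =>
            rcases (chs x n).alt with h | h
            · exact h.1.trans ih
            · exact absurd ⟨n, hn, h⟩ hcon
        obtain ⟨n, hn⟩ := hb (s x N).j
        rcases le_total N n with h | h
        · rw [this n h] at hn
          exact lt_irrefl _ hn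
        · exact absurd (jmono h) (not_le.2 hn)
      constructor
      · intro hx
        exfalso
        obtain ⟨i, hi⟩ := mem_iUnion.1 (h1.cov hx)
        obtain ⟨N, hN⟩ := hb (2 * i)
        obtain ⟨n, hn, _, hd, _⟩ := hjump N
        have hj : (s x N).j ≤ (s x n).j := jmono hn
        have : x ∈ (s x n).P := (hs x n).1.hK i (by omega) ⟨hi, (hs x n).2.1⟩
        exact Set.disjoint_left.1 hd (hs x (n+1)).2.1 this
      · intro hx
        exfalso
        obtain ⟨i, hi⟩ := mem_iUnion.1 (h2.cov hx)
        obtain ⟨N, hN⟩ := hb (2 * i + 1)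
        obtain ⟨n, hn, _, _, hd⟩ := hjump N
        have hj : (s x N).j ≤ (s x n).j := jmono hn
        have : f x ∈ (s x n).Q := (hs x n).1.hL i (by omega) ⟨hi, hf x n⟩
        exact Set.disjoint_left.1 hd (hf x (n+1)) this
  refine ⟨⟨⟨f, f', hff, hff'⟩, hfc, hfc'⟩, ?_⟩
  ext y
  constructor
  · rintro ⟨x, hx, rfl⟩
    exact (hX x).1 hx
  · intro hy
    refine ⟨f' y, ?_, hff' y⟩
    rw [hX, hff']
    exact hy

theorem mainC (hκ : Cardinal.aleph0 < Cardinal.mk κ) (X₁ X₂ : Set (ℕ → κ))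
    (hd₁ : Dense X₁) (hd₂ : Dense X₂)
    (hf₁ : IsFsigmaDelta X₁) (hf₂ : IsFsigmaDelta X₂)
    (hc₁ : FirstCategory ↥X₁) (hc₂ : FirstCategory ↥X₂)
    (hn₁ : NowhereSLWplusGDS ↥X₁ (Cardinal.mk κ)) (hn₂ : NowhereSLWplusGDS ↥X₂ (Cardinal.mk κ)) :
    ∃ f : (ℕ → κ) ≃ₜ (ℕ → κ), f '' X₁ = X₂ := by
  obtain ⟨K, hK⟩ := exists_good hκ hd₁ hf₁ hc₁ hn₁
  obtain ⟨L, hL⟩ := exists_good hκ hd₂ hf₂ hc₂ hn₂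
  exact mainB hκ hK hL

end PartSix

/-- Theorem `tqc`: any two dense first-category `F_σδ`-subsets of `B(k)`
(`k > ω`) which are nowhere `σLW(<k) + 𝒢_δσ` are equivalently placed: some
autohomeomorphism of `B(k)` carries one onto the other. -/
theorem stmt_7 (k : Cardinal.{u}) (hk : Cardinal.aleph0 < k)
    (X₁ X₂ : Set (BaireB k)) (hd₁ : Dense X₁) (hd₂ : Dense X₂)
    (hf₁ : IsFsigmaDelta X₁) (hf₂ : IsFsigmaDelta X₂)
    (hc₁ : FirstCategory ↥X₁) (hc₂ : FirstCategory ↥X₂)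
    (hn₁ : NowhereSLWplusGDS ↥X₁ k) (hn₂ : NowhereSLWplusGDS ↥X₂ k) :
    ∃ f : BaireB k ≃ₜ BaireB k, f '' X₁ = X₂ := by
  have hm : Cardinal.mk (DiscT k) = k := Cardinal.mk_out k
  exact mainC (κ := DiscT k) (by rw [hm]; exact hk) X₁ X₂ hd₁ hd₂ hf₁ hf₂ hc₁ hc₂
    (by rw [hm]; exact hn₁) (by rw [hm]; exact hn₂)
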